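/- arXiv:2201.12641 — 4 statements merged into one kernel-verified Lean document; each statement's English description precedes it below -/
import Mathlib

section
/- (L¹-contraction on the torus.) Let u and v be two classical L-periodic solutions of the unforced conservation law ∂_t u = ∂_x(κ(u)∂_x u − H(u)) on [0,T]. Then for every t ∈ [0,T], ∫₀^L |u(t,x) − v(t,x)| dx ≤ ∫₀^L |u(0,x) − v(0,x)| dx. -/
open Real Set MeasureTheory intervalIntegral

noncomputable section

/-- Partial derivative in time. -/
def pdT (u : ℝ → ℝ → ℝ) (t x : ℝ) : ℝ := deriv (fun s => u s x) t

/-- Partial derivative in space. -/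
def pdX (u : ℝ → ℝ → ℝ) (t x : ℝ) : ℝ := deriv (fun y => u t y) x

/-- A classical `L`-periodic solution of `∂ₜ u = ∂ₓ(κ(u) ∂ₓ u − H(u))` on `[0,T]`:
continuous on `[0,T] × ℝ`, `L`-periodic, `C¹` in `t` and `C²` in `x` on `(0,T] × ℝ`,
satisfying the PDE pointwise there. -/
structure IsClassicalPeriodicSol (κ H : ℝ → ℝ) (L T : ℝ) (u : ℝ → ℝ → ℝ) : Prop where
  cont : ContinuousOn (fun p : ℝ × ℝ => u p.1 p.2) (Icc 0 T ×ˢ (univ : Set ℝ))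
  periodic : ∀ t ∈ Icc 0 T, ∀ x, u t (x + L) = u t x
  reg_t : ∀ x, ContDiffOn ℝ 1 (fun s => u s x) (Ioc 0 T)
  reg_x : ∀ t ∈ Ioc 0 T, ContDiff ℝ 2 (fun y => u t y)
  pde : ∀ t ∈ Ioc 0 T, ∀ x,
    pdT u t x = deriv (fun y => κ (u t y) * pdX u t y - H (u t y)) x


open Filter Topology

lemma ae_hasDerivAt_eq_zero_of_eq_zero (f : ℝ → ℝ) :
    ∀ᵐ x, f x = 0 → ∀ d, HasDerivAt f d x → d = 0 := by
  have hc := (countable_setOfPred_isolated_right_within (s := {x : ℝ | f x = 0})).ae_notMem volume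
  filter_upwards [hc] with x hx h0 d hd
  by_contra hne
  apply hx
  refine ⟨h0, ?_⟩
  have h1 : ∀ᶠ z in 𝓝[{x : ℝ | f x = 0} ∩ Ioi x] x, f z ≠ 0 :=
    (hd.eventually_ne (c := 0) hne).filter_mono
      (nhdsWithin_mono _ fun z hz => (ne_of_gt hz.2 : z ≠ x))
  have h2 : ∀ᶠ z in 𝓝[{x : ℝ | f x = 0} ∩ Ioi x] x, f z = 0 := by
    filter_upwards [self_mem_nhdsWithin] with z hz using hz.1
  rw [← eventually_false_iff_eq_bot]
  filter_upwards [h1, h2] with z a b using a b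

lemma HasDerivAt.abs_of_eq_zero_imp {f : ℝ → ℝ} {d t : ℝ} (hf : HasDerivAt f d t)
    (h : f t = 0 → d = 0) :
    HasDerivAt (fun s => |f s|) ((SignType.sign (f t) : ℝ) * d) t := by
  by_cases h0 : f t = 0
  · have hd := h h0
    subst hd
    rw [mul_zero, hasDerivAt_iff_isLittleO] at *
    simp only [h0, sub_zero, smul_zero, abs_zero] at *
    simpa using hf.norm_left
  · exact (hasDerivAt_abs h0).comp t hf

lemma tendsto_arctan_nat_mul (s : ℝ) :
    Tendsto (fun n : ℕ => arctan (n * s)) atTop (𝓝 (π / 2 * (SignType.sign s : ℝ))) := by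
  rcases lt_trichotomy s 0 with hs | hs | hs
  · have h : Tendsto (fun n : ℕ => (n : ℝ) * s) atTop atBot :=
      tendsto_natCast_atTop_atTop.atTop_mul_const_of_neg hs
    simpa [hs, Function.comp_def] using (tendsto_nhds_of_tendsto_nhdsWithin tendsto_arctan_atBot).comp h
  · simp [hs]
  · have h : Tendsto (fun n : ℕ => (n : ℝ) * s) atTop atTop :=
      tendsto_natCast_atTop_atTop.atTop_mul_const hs
    simpa [hs, Function.comp_def] using (tendsto_nhds_of_tendsto_nhdsWithin tendsto_arctan_atTop).comp h

/-- A `C¹` function has bounded derivative on `[-R, R]` and is Lipschitz there. -/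
lemma exists_lipschitz_bound {φ : ℝ → ℝ} (hφ : ContDiff ℝ 1 φ) (R : ℝ) :
    ∃ C, 0 ≤ C ∧ (∀ a ∈ Icc (-R) R, |deriv φ a| ≤ C) ∧
      ∀ a ∈ Icc (-R) R, ∀ b ∈ Icc (-R) R, |φ a - φ b| ≤ C * |a - b| := by
  obtain ⟨C, hC⟩ := (isCompact_Icc (a := -R) (b := R)).exists_bound_of_continuousOn
    (hφ.continuous_deriv le_rfl).continuousOn
  have hC' : ∀ a ∈ Icc (-R) R, ‖deriv φ a‖ ≤ max C 0 := fun a ha => (hC a ha).trans (le_max_left _ _)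
  refine ⟨max C 0, le_max_right _ _, hC', fun a ha b hb => ?_⟩
  exact Convex.norm_image_sub_le_of_norm_deriv_le
    (fun x _ => (hφ.differentiable one_ne_zero).differentiableAt) hC' (convex_Icc _ _) hb ha

/-- The flux `κ(f) f' - H(f)` of a profile `f`. -/
def flux (κ H f : ℝ → ℝ) (y : ℝ) : ℝ := κ (f y) * deriv f y - H (f y)

lemma contDiff_flux {κ H f : ℝ → ℝ} (hκ : ContDiff ℝ 1 κ) (hH : ContDiff ℝ 1 H)
    (hf : ContDiff ℝ 2 f) : ContDiff ℝ 1 (flux κ H f) := by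
  have h1 : ContDiff ℝ 1 f := hf.of_le (by norm_num)
  have h2 : ContDiff ℝ 1 (deriv f) := ((contDiff_succ_iff_deriv (n := 1)).1 hf).2.2
  exact ((hκ.comp h1).mul h2).sub (hH.comp h1)

lemma deriv_flux {κ H f : ℝ → ℝ} (hκ : ContDiff ℝ 1 κ) (hH : ContDiff ℝ 1 H)
    (hf : ContDiff ℝ 2 f) (y : ℝ) :
    deriv (flux κ H f) y = deriv κ (f y) * deriv f y ^ 2 + κ (f y) * deriv (deriv f) y
      - deriv H (f y) * deriv f y := by
  have h1 : HasDerivAt f (deriv f y) y := (hf.differentiable two_ne_zero y).hasDerivAt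
  have h2 : HasDerivAt (deriv f) (deriv (deriv f) y) y :=
    ((((contDiff_succ_iff_deriv (n := 1)).1 hf).2.2).differentiable one_ne_zero y).hasDerivAt
  have hk : HasDerivAt κ (deriv κ (f y)) (f y) := (hκ.differentiable one_ne_zero _).hasDerivAt
  have hh : HasDerivAt H (deriv H (f y)) (f y) := (hH.differentiable one_ne_zero _).hasDerivAt
  have := (((hk.comp y h1).mul h2).sub (hh.comp y h1)).deriv
  refine Eq.trans this ?_
  simp only [Function.comp_apply]
  ring

lemma flux_periodic {κ H f : ℝ → ℝ} {L : ℝ} (hf : ∀ x, f (x + L) = f x) (x : ℝ) :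
    flux κ H f (x + L) = flux κ H f x := by
  have h : deriv f (x + L) = deriv f x := by
    rw [← deriv_comp_add_const f L x]
    exact congrArg (fun g => deriv g x) (funext hf)
  simp only [flux, hf, h]

/-- The flux operator is accretive in `L¹` of the torus. -/
lemma integral_sign_mul_deriv_flux_le_zero {κ H f g : ℝ → ℝ} {κ₀ L : ℝ} (hκ₀ : 0 < κ₀)
    (hκb : ∀ s, κ₀ ≤ κ s) (hκ : ContDiff ℝ 1 κ) (hH : ContDiff ℝ 1 H) (hL : 0 < L)
    (hf : ContDiff ℝ 2 f) (hg : ContDiff ℝ 2 g)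
    (hfp : ∀ x, f (x + L) = f x) (hgp : ∀ x, g (x + L) = g x) :
    ∫ x in (0:ℝ)..L, (SignType.sign (f x - g x) : ℝ) *
      (deriv (flux κ H f) x - deriv (flux κ H g) x) ≤ 0 := by
  have hfc := hf.continuous
  have hgc := hg.continuous
  have hf' : Continuous (deriv f) := hf.continuous_deriv (by norm_num)
  have hg' : Continuous (deriv g) := hg.continuous_deriv (by norm_num)
  have hJf := contDiff_flux hκ hH hf
  have hJg := contDiff_flux hκ hH hg
  have hdJf := hJf.continuous_deriv le_rfl
  have hdJg := hJg.continuous_deriv le_rfl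
  obtain ⟨R₁, hR₁⟩ := (isCompact_Icc (a := (0:ℝ)) (b := L)).exists_bound_of_continuousOn
    hfc.continuousOn
  obtain ⟨R₂, hR₂⟩ := (isCompact_Icc (a := (0:ℝ)) (b := L)).exists_bound_of_continuousOn
    hgc.continuousOn
  obtain ⟨D, hD⟩ := (isCompact_Icc (a := (0:ℝ)) (b := L)).exists_bound_of_continuousOn
    hg'.continuousOn
  obtain ⟨Cκ, hCκ0, -, hCκ⟩ := exists_lipschitz_bound hκ (max R₁ R₂)
  obtain ⟨CH, hCH0, -, hCH⟩ := exists_lipschitz_bound hH (max R₁ R₂)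
  have hrem : ∀ y ∈ Icc 0 L, |(κ (f y) - κ (g y)) * deriv g y - (H (f y) - H (g y))|
      ≤ (Cκ * D + CH) * |f y - g y| := by
    intro y hy
    have hfy : f y ∈ Icc (-max R₁ R₂) (max R₁ R₂) :=
      abs_le.1 ((hR₁ y hy).trans (le_max_left _ _))
    have hgy : g y ∈ Icc (-max R₁ R₂) (max R₁ R₂) :=
      abs_le.1 ((hR₂ y hy).trans (le_max_right _ _))
    have e1 := hCκ _ hfy _ hgy
    have e2 := hCH _ hfy _ hgy
    have e3 : |deriv g y| ≤ D := hD y hy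
    calc _ ≤ |(κ (f y) - κ (g y)) * deriv g y| + |H (f y) - H (g y)| := abs_sub _ _
      _ ≤ (Cκ * |f y - g y|) * D + CH * |f y - g y| := by
        rw [abs_mul]
        gcongr
      _ = _ := by ring
  set C := Cκ * D + CH
  set w : ℝ → ℝ := fun y => f y - g y with hw
  set P : ℝ → ℝ := fun y => flux κ H f y - flux κ H g y with hP
  set Q : ℝ → ℝ := fun y => deriv (flux κ H f) y - deriv (flux κ H g) y with hQ
  have hQc : Continuous Q := hdJf.sub hdJg
  have hwc : Continuous w := hfc.sub hgc
  have hPc : Continuous P := hJf.continuous.sub hJg.continuous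
  set w' : ℝ → ℝ := fun y => deriv f y - deriv g y with hw'
  have hw'c : Continuous w' := hf'.sub hg'
  have hwd : ∀ y, HasDerivAt w (w' y) y := fun y =>
    (hf.differentiable two_ne_zero y).hasDerivAt.sub (hg.differentiable two_ne_zero y).hasDerivAt
  have hPd : ∀ y, HasDerivAt P (Q y) y := fun y =>
    (hJf.differentiable one_ne_zero y).hasDerivAt.sub
      (hJg.differentiable one_ne_zero y).hasDerivAt
  have key : ∀ n : ℕ, 0 < n →
      ∫ x in (0:ℝ)..L, arctan (n * w x) * Q x ≤ L * (C ^ 2 / (4 * κ₀)) * (n : ℝ)⁻¹ := by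
    intro n hn
    have hn' : (0:ℝ) < n := by exact_mod_cast hn
    set dη : ℝ → ℝ := fun y => 1 / (1 + (n * w y) ^ 2) * (n * w' y) with hdη
    have hpos : ∀ y, (0:ℝ) < 1 + (n * w y) ^ 2 := fun y => by positivity
    have hdηc : Continuous dη := by
      refine (continuous_const.div (by fun_prop) fun y => (hpos y).ne').mul (by fun_prop)
    have hd : ∀ y, HasDerivAt (fun y => arctan (n * w y) * P y)
        (dη y * P y + arctan (n * w y) * Q y) y := fun y =>
      (((hwd y).const_mul (n:ℝ)).arctan).mul (hPd y)
    have hηc : Continuous fun y => arctan (n * w y) :=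
      continuous_arctan.comp (continuous_const.mul hwc)
    have hsumc : Continuous fun y => dη y * P y + arctan (n * w y) * Q y :=
      (hdηc.mul hPc).add (hηc.mul hQc)
    have hint : ∫ y in (0:ℝ)..L, (dη y * P y + arctan (n * w y) * Q y) = 0 := by
      rw [integral_eq_sub_of_hasDerivAt (fun y _ => hd y)
        (hsumc.intervalIntegrable _ _)]
      have a := hfp 0
      have b := hgp 0
      have c := flux_periodic (κ := κ) (H := H) hfp 0
      have d := flux_periodic (κ := κ) (H := H) hgp 0
      simp only [zero_add] at a b c d
      simp [hw, hP, a, b, c, d]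
    have hmono : ∫ y in (0:ℝ)..L, arctan (n * w y) * Q y ≤
        ∫ y in (0:ℝ)..L, ((dη y * P y + arctan (n * w y) * Q y)
          + C ^ 2 / (4 * κ₀) * (n : ℝ)⁻¹) := by
      refine integral_mono_on hL.le ((hηc.mul hQc).intervalIntegrable _ _)
        ((hsumc.add continuous_const).intervalIntegrable _ _) ?_
      intro y hy
      have hr := hrem y hy
      set r := (κ (f y) - κ (g y)) * deriv g y - (H (f y) - H (g y)) with hrdef
      have hPy : P y = κ (f y) * w' y + r := by
        simp only [hP, hw', hrdef, flux]; ring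
      have h1 : -(C ^ 2 / (4 * κ₀)) * w y ^ 2 ≤ w' y * P y := by
        have h2 : κ₀ * w' y ^ 2 ≤ κ (f y) * w' y ^ 2 :=
          mul_le_mul_of_nonneg_right (hκb _) (sq_nonneg _)
        have h3 : -(C * |w y|) * |w' y| ≤ w' y * r := by
          have : |w' y * r| ≤ C * |w y| * |w' y| := by
            rw [abs_mul, mul_comm]
            exact mul_le_mul_of_nonneg_right hr (abs_nonneg _)
          linarith [neg_abs_le (w' y * r)]
        have h4 : 0 ≤ κ₀ * (|w' y| - C * |w y| / (2 * κ₀)) ^ 2 := by positivity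
        have h5 : κ₀ * (|w' y| - C * |w y| / (2 * κ₀)) ^ 2
            = κ₀ * w' y ^ 2 - C * |w y| * |w' y| + C ^ 2 / (4 * κ₀) * w y ^ 2 := by
          rw [← sq_abs (w' y), ← sq_abs (w y)]
          field_simp
          ring
        rw [hPy]
        nlinarith
      have h6 : dη y * P y = n / (1 + (n * w y) ^ 2) * (w' y * P y) := by
        simp only [hdη]; ring
      have h7 : n / (1 + (n * w y) ^ 2) * w y ^ 2 ≤ (n : ℝ)⁻¹ := by
        rw [div_mul_eq_mul_div, div_le_iff₀ (hpos y)]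
        field_simp
        nlinarith
      have h8 : n / (1 + (n * w y) ^ 2) * (-(C ^ 2 / (4 * κ₀)) * w y ^ 2) ≤
          n / (1 + (n * w y) ^ 2) * (w' y * P y) :=
        mul_le_mul_of_nonneg_left h1 (div_nonneg hn'.le (hpos y).le)
      have h9 : (C ^ 2 / (4 * κ₀)) * (n / (1 + (n * w y) ^ 2) * w y ^ 2)
          ≤ (C ^ 2 / (4 * κ₀)) * (n : ℝ)⁻¹ :=
        mul_le_mul_of_nonneg_left h7 (by positivity)
      rw [h6]
      linarith
    rw [integral_add (hsumc.intervalIntegrable _ _)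
      (continuous_const.intervalIntegrable _ _), hint] at hmono
    simp only [intervalIntegral.integral_const, sub_zero, smul_eq_mul, zero_add] at hmono
    linarith
  have hlim : Tendsto (fun n : ℕ => ∫ x in (0:ℝ)..L, arctan (n * w x) * Q x) atTop
      (𝓝 (∫ x in (0:ℝ)..L, π / 2 * (SignType.sign (w x) : ℝ) * Q x)) := by
    refine tendsto_integral_filter_of_dominated_convergence (fun x => π / 2 * |Q x|) ?_ ?_ ?_ ?_
    · refine Eventually.of_forall fun n => Continuous.aestronglyMeasurable ?_
      exact (continuous_arctan.comp (continuous_const.mul hwc)).mul hQc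
    · refine Eventually.of_forall fun n => Eventually.of_forall fun x _ => ?_
      rw [norm_mul]
      refine mul_le_mul_of_nonneg_right ?_ (abs_nonneg _)
      exact abs_le.2 ⟨(neg_pi_div_two_lt_arctan _).le, (arctan_lt_pi_div_two _).le⟩
    · exact (continuous_const.mul hQc.abs).intervalIntegrable _ _
    · exact Eventually.of_forall fun x _ => (tendsto_arctan_nat_mul (w x)).mul_const _
  have hlim2 : Tendsto (fun n : ℕ => L * (C ^ 2 / (4 * κ₀)) * (n : ℝ)⁻¹) atTop (𝓝 0) := by
    simpa using (tendsto_inv_atTop_nhds_zero_nat (𝕜 := ℝ)).const_mul (L * (C ^ 2 / (4 * κ₀)))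
  have hle := le_of_tendsto_of_tendsto hlim hlim2
    ((eventually_gt_atTop 0).mono fun n hn => key n hn)
  simp only [mul_assoc] at hle
  rw [intervalIntegral.integral_const_mul] at hle
  exact nonpos_of_mul_nonpos_right hle (by positivity)

lemma deriv_deriv_nonpos_of_forall_le {f : ℝ → ℝ} {x : ℝ} (hf : ContDiff ℝ 2 f)
    (hx : ∀ y, f y ≤ f x) : deriv f x = 0 ∧ deriv (deriv f) x ≤ 0 := by
  have hmax : IsLocalMax f x := Eventually.of_forall hx
  have h0 : deriv f x = 0 := hmax.deriv_eq_zero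
  refine ⟨h0, ?_⟩
  by_contra hpos
  push Not at hpos
  have hmin : IsLocalMin f x := isLocalMin_of_deriv_deriv_pos hpos h0 hf.continuous.continuousAt
  have hconst : f =ᶠ[𝓝 x] fun _ => f x := by
    filter_upwards [hmin] with y hy using le_antisymm (hx y) hy
  have h1 : deriv f =ᶠ[𝓝 x] deriv (fun _ => f x) := hconst.deriv
  have h2 := h1.deriv_eq
  simp only [deriv_const'] at h2
  exact hpos.ne' h2

/-- A weak maximum principle: if the time derivative of a space-periodic function is at most `M`
at every spatial maximum, the function grows at most linearly with rate `M`. -/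
lemma le_mul_of_deriv_le_at_max {z : ℝ → ℝ → ℝ} {t₁ t₂ L M : ℝ} (hL : 0 < L)
    (hc : ContinuousOn (fun p : ℝ × ℝ => z p.1 p.2) (Icc t₁ t₂ ×ˢ univ))
    (hper : ∀ t ∈ Icc t₁ t₂, ∀ x, z t (x + L) = z t x)
    (hinit : ∀ x, z t₁ x ≤ 0)
    (hder : ∀ t ∈ Ioc t₁ t₂, ∀ x ∈ Icc 0 L, (∀ y, z t y ≤ z t x) →
      ∃ d ≤ M, HasDerivAt (fun s => z s x) d t) :
    ∀ t ∈ Icc t₁ t₂, ∀ x ∈ Icc 0 L, z t x ≤ M * (t - t₁) := by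
  intro t ht x hx
  suffices h : ∀ M' > M, z t x ≤ M' * (t - t₁) by
    have hlim : Tendsto (fun M' => M' * (t - t₁)) (𝓝[>] M) (𝓝 (M * (t - t₁))) :=
      ((continuous_id.mul continuous_const).tendsto M).mono_left nhdsWithin_le_nhds
    exact ge_of_tendsto hlim (by filter_upwards [self_mem_nhdsWithin] with M' hM' using h M' hM')
  intro M' hM'
  have hc' : ContinuousOn (fun p : ℝ × ℝ => z p.1 p.2 - M' * (p.1 - t₁))
      (Icc t₁ t₂ ×ˢ Icc 0 L) :=
    (hc.mono (prod_mono_right (subset_univ _))).sub (by fun_prop)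
  obtain ⟨⟨s, a⟩, ⟨hs, ha⟩, hmax⟩ := (isCompact_Icc.prod isCompact_Icc).exists_isMaxOn
    ⟨(t, x), ht, hx⟩ hc'
  have hmax' : ∀ r ∈ Icc t₁ t₂, ∀ b ∈ Icc 0 L,
      z r b - M' * (r - t₁) ≤ z s a - M' * (s - t₁) :=
    fun r hr b hb => hmax (show (r, b) ∈ Icc t₁ t₂ ×ˢ Icc 0 L from ⟨hr, hb⟩)
  simp only at hs ha
  rcases hs.1.eq_or_lt with h | h
  · have h1 := hmax' t ht x hx
    have h2 := hinit a
    rw [← h] at h1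
    linarith
  · exfalso
    have hsp : ∀ y, z s y ≤ z s a := by
      intro y
      obtain ⟨y', hy', hyy'⟩ := Function.Periodic.exists_mem_Ico₀ (f := z s) (hper s hs) hL y
      have := hmax' s hs y' ⟨hy'.1, hy'.2.le⟩
      rw [hyy']
      linarith
    obtain ⟨d, hd, hderiv⟩ := hder s ⟨h, hs.2⟩ a ha hsp
    have hslope : Tendsto (slope (fun r => z r a) s) (𝓝[<] s) (𝓝 d) :=
      (hasDerivAt_iff_tendsto_slope.1 hderiv).mono_left
        (nhdsWithin_mono _ fun r hr => (ne_of_lt hr : r ≠ s))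
    have : M' ≤ d := by
      refine ge_of_tendsto hslope ?_
      filter_upwards [Ioo_mem_nhdsLT h] with r hr
      have h1 := hmax' r ⟨hr.1.le, hr.2.le.trans hs.2⟩ a ha
      rw [slope_def_field, le_div_iff_of_neg (by linarith [hr.2])]
      linarith
    linarith

section Solution

variable {κ H : ℝ → ℝ} {L T : ℝ} {u v : ℝ → ℝ → ℝ}

lemma IsClassicalPeriodicSol.hasDerivAt (hu : IsClassicalPeriodicSol κ H L T u) {t : ℝ}
    (ht : t ∈ Ioo 0 T) (x : ℝ) :
    HasDerivAt (fun s => u s x) (deriv (flux κ H (u t)) x) t := by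
  have h := ((hu.reg_t x).differentiableOn one_ne_zero).differentiableAt
    (Ioc_mem_nhds ht.1 ht.2)
  have e : deriv (fun s => u s x) t = deriv (flux κ H (u t)) x := hu.pde t ⟨ht.1, ht.2.le⟩ x
  exact e ▸ h.hasDerivAt

lemma IsClassicalPeriodicSol.exists_bound (hu : IsClassicalPeriodicSol κ H L T u) :
    ∃ R, ∀ t ∈ Icc 0 T, ∀ x ∈ Icc 0 L, |u t x| ≤ R := by
  obtain ⟨R, hR⟩ := (isCompact_Icc.prod isCompact_Icc).exists_bound_of_continuousOn
    (hu.cont.mono (prod_mono_right (subset_univ (Icc 0 L))))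
  exact ⟨R, fun t ht x hx => hR (t, x) ⟨ht, hx⟩⟩

/-- Interior classical solutions are one-sided Lipschitz in time, uniformly in space:
the barriers `u(t₁, x) ± M (t - t₁)` enclose the solution. -/
lemma IsClassicalPeriodicSol.exists_abs_sub_le (hu : IsClassicalPeriodicSol κ H L T u)
    {κ₁ : ℝ} (hκ0 : ∀ s, 0 ≤ κ s) (hκ1 : ∀ s, κ s ≤ κ₁)
    (hκ : ContDiff ℝ 1 κ) (hH : ContDiff ℝ 1 H) (hL : 0 < L)
    {t₁ : ℝ} (ht₁ : t₁ ∈ Ioo 0 T) :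
    ∃ M, ∀ t ∈ Ico t₁ T, ∀ x ∈ Icc 0 L, |u t x - u t₁ x| ≤ M * (t - t₁) := by
  obtain ⟨R, hR⟩ := hu.exists_bound
  obtain ⟨A, hA0, hA, -⟩ := exists_lipschitz_bound hκ R
  obtain ⟨B, hB0, hB, -⟩ := exists_lipschitz_bound hH R
  have hf : ContDiff ℝ 2 (u t₁) := hu.reg_x t₁ ⟨ht₁.1, ht₁.2.le⟩
  have hf1 : ContDiff ℝ 1 (deriv (u t₁)) := ((contDiff_succ_iff_deriv (n := 1)).1 hf).2.2
  obtain ⟨D₁, hD₁⟩ := (isCompact_Icc (a := (0:ℝ)) (b := L)).exists_bound_of_continuousOn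
    hf1.continuous.continuousOn
  obtain ⟨D₂, hD₂⟩ := (isCompact_Icc (a := (0:ℝ)) (b := L)).exists_bound_of_continuousOn
    (hf1.continuous_deriv le_rfl).continuousOn
  have hside : ∀ σ : ℝ, |σ| = 1 → ∀ t ∈ Ico t₁ T, ∀ x ∈ Icc 0 L,
      σ * (u t x - u t₁ x) ≤ (A * D₁ ^ 2 + κ₁ * D₂ + B * D₁) * (t - t₁) := by
    intro σ hσ t ht
    refine le_mul_of_deriv_le_at_max (z := fun t x => σ * (u t x - u t₁ x)) (t₁ := t₁) (t₂ := t)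
      hL ?_ ?_ (by simp) ?_ t ⟨ht.1, le_rfl⟩
    · refine continuousOn_const.mul (ContinuousOn.sub ?_ ?_)
      · exact hu.cont.mono (prod_mono_left (Icc_subset_Icc ht₁.1.le ht.2.le))
      · exact (hf.continuous.comp continuous_snd).continuousOn
    · intro s hs x
      simp only [hu.periodic s ⟨ht₁.1.le.trans hs.1, hs.2.trans ht.2.le⟩ x,
        hu.periodic t₁ ⟨ht₁.1.le, ht₁.2.le⟩ x]
    · intro s hs x hx hmax
      have hs' : s ∈ Ioo 0 T := ⟨ht₁.1.trans hs.1, hs.2.trans_lt ht.2⟩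
      refine ⟨_, ?_, ((hu.hasDerivAt hs' x).sub_const _).const_mul σ⟩
      have hg : ContDiff ℝ 2 (u s) := hu.reg_x s ⟨hs'.1, hs'.2.le⟩
      have hg1 : ContDiff ℝ 1 (deriv (u s)) := ((contDiff_succ_iff_deriv (n := 1)).1 hg).2.2
      obtain ⟨e1, e2⟩ := deriv_deriv_nonpos_of_forall_le
        (contDiff_const.mul (hg.sub hf) : ContDiff ℝ 2 fun y => σ * (u s y - u t₁ y)) hmax
      have d1 : deriv (fun y => σ * (u s y - u t₁ y)) =
          fun y => σ * (deriv (u s) y - deriv (u t₁) y) := by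
        funext y
        exact (((hg.differentiable two_ne_zero y).hasDerivAt.sub
          (hf.differentiable two_ne_zero y).hasDerivAt).const_mul σ).deriv
      have d2 : deriv (fun y => σ * (deriv (u s) y - deriv (u t₁) y)) x =
          σ * (deriv (deriv (u s)) x - deriv (deriv (u t₁)) x) :=
        (((hg1.differentiable one_ne_zero x).hasDerivAt.sub
          (hf1.differentiable one_ne_zero x).hasDerivAt).const_mul σ).deriv
      rw [d1] at e1 e2
      rw [d2] at e2
      have hσ0 : σ ≠ 0 := by rintro rfl; simp at hσ
      have e1' : deriv (u s) x = deriv (u t₁) x := by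
        simpa [hσ0, sub_eq_zero] using e1
      have hmem : u s x ∈ Icc (-R) R := abs_le.1 (hR s ⟨hs'.1.le, hs'.2.le⟩ x hx)
      have b1 : |deriv (u t₁) x| ≤ D₁ := hD₁ x hx
      have b2 : |deriv (deriv (u t₁)) x| ≤ D₂ := hD₂ x hx
      have b3 := hA _ hmem
      have b4 := hB _ hmem
      rw [deriv_flux hκ hH hg, e1']
      have m0 : κ (u s x) * (σ * deriv (deriv (u s)) x)
          ≤ κ (u s x) * (σ * deriv (deriv (u t₁)) x) :=
        mul_le_mul_of_nonneg_left (by linarith) (hκ0 _)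
      have m1 : σ * (deriv κ (u s x) * deriv (u t₁) x ^ 2) ≤ A * D₁ ^ 2 := by
        refine (le_abs_self _).trans ?_
        rw [abs_mul, hσ, one_mul, abs_mul, abs_pow]
        gcongr
      have m2 : κ (u s x) * (σ * deriv (deriv (u t₁)) x) ≤ κ₁ * D₂ := by
        refine (le_abs_self _).trans ?_
        rw [abs_mul, abs_mul, hσ, one_mul, abs_of_nonneg (hκ0 _)]
        exact mul_le_mul (hκ1 _) b2 (abs_nonneg _) ((hκ0 0).trans (hκ1 0))
      have m3 : -(σ * (deriv H (u s x) * deriv (u t₁) x)) ≤ B * D₁ := by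
        refine (neg_le_abs _).trans ?_
        rw [abs_mul, hσ, one_mul, abs_mul]
        gcongr
      linarith
  refine ⟨A * D₁ ^ 2 + κ₁ * D₂ + B * D₁, fun t ht x hx => abs_le'.2 ⟨?_, ?_⟩⟩
  · simpa using hside 1 (by simp) t ht x hx
  · simpa using hside (-1) (by simp) t ht x hx

lemma continuousOn_integral_abs_sub (hT : 0 ≤ T) (hu : IsClassicalPeriodicSol κ H L T u)
    (hv : IsClassicalPeriodicSol κ H L T v) :
    ContinuousOn (fun t => ∫ x in (0:ℝ)..L, |u t x - v t x|) (Icc 0 T) := by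
  have hext : ∀ {w : ℝ → ℝ → ℝ}, IsClassicalPeriodicSol κ H L T w →
      Continuous fun p : ℝ × ℝ => w (projIcc 0 T hT p.1) p.2 := fun hw =>
    hw.cont.comp_continuous
      (f := fun p : ℝ × ℝ => (((projIcc 0 T hT p.1 : Icc 0 T) : ℝ), p.2))
      (by fun_prop) fun p => ⟨(projIcc 0 T hT p.1).2, mem_univ _⟩
  have h : Continuous fun t => ∫ x in (0:ℝ)..L,
      |u (projIcc 0 T hT t) x - v (projIcc 0 T hT t) x| :=
    intervalIntegral.continuous_parametric_intervalIntegral_of_continuous'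
      (f := fun t x => |u (projIcc 0 T hT t) x - v (projIcc 0 T hT t) x|)
      ((hext hu).sub (hext hv)).abs 0 L
  refine h.continuousOn.congr fun t ht => ?_
  simp only [projIcc_of_mem hT ht]

/-- The right derivative of the `L¹` distance of two solutions is nonpositive. -/
lemma exists_hasDerivWithinAt_integral_abs_sub {κ₀ κ₁ : ℝ} (hκ₀ : 0 < κ₀)
    (hκb : ∀ s, κ₀ ≤ κ s ∧ κ s ≤ κ₁) (hκ : ContDiff ℝ 1 κ) (hH : ContDiff ℝ 1 H) (hL : 0 < L)
    (hu : IsClassicalPeriodicSol κ H L T u) (hv : IsClassicalPeriodicSol κ H L T v)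
    {t : ℝ} (ht : t ∈ Ioo 0 T) :
    ∃ d ≤ 0, HasDerivWithinAt (fun t => ∫ x in (0:ℝ)..L, |u t x - v t x|) d (Ici t) t := by
  have htc : t ∈ Icc 0 T := ⟨ht.1.le, ht.2.le⟩
  have hto : t ∈ Ioc 0 T := ⟨ht.1, ht.2.le⟩
  have hf := hu.reg_x t hto
  have hg := hv.reg_x t hto
  refine ⟨_, integral_sign_mul_deriv_flux_le_zero hκ₀ (fun s => (hκb s).1) hκ hH hL hf hg
    (hu.periodic t htc) (hv.periodic t htc), ?_⟩
  obtain ⟨M₁, hM₁⟩ := hu.exists_abs_sub_le (fun s => hκ₀.le.trans (hκb s).1)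
    (fun s => (hκb s).2) hκ hH hL ht
  obtain ⟨M₂, hM₂⟩ := hv.exists_abs_sub_le (fun s => hκ₀.le.trans (hκb s).1)
    (fun s => (hκb s).2) hκ hH hL ht
  have hcont : ∀ s ∈ Icc 0 T, Continuous fun x => |u s x - v s x| := by
    have hsl : ∀ {w : ℝ → ℝ → ℝ}, IsClassicalPeriodicSol κ H L T w → ∀ s ∈ Icc 0 T,
        Continuous fun x => w s x := fun hw s hs =>
      hw.cont.comp_continuous (f := fun x => (s, x)) (by fun_prop) fun x => ⟨hs, mem_univ _⟩
    exact fun s hs => ((hsl hu s hs).sub (hsl hv s hs)).abs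
  rw [← hasDerivWithinAt_Ioi_iff_Ici, hasDerivWithinAt_iff_tendsto_slope' self_notMem_Ioi]
  have hev : ∀ᶠ s in 𝓝[>] t, s ∈ Ioo t T := Ioo_mem_nhdsGT ht.2
  have hlim : Tendsto (fun s => ∫ x in (0:ℝ)..L, slope (fun s => |u s x - v s x|) t s) (𝓝[>] t)
      (𝓝 (∫ x in (0:ℝ)..L, (SignType.sign (u t x - v t x) : ℝ) *
        (deriv (flux κ H (u t)) x - deriv (flux κ H (v t)) x))) := by
    refine tendsto_integral_filter_of_dominated_convergence (fun _ => M₁ + M₂) ?_ ?_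
      (continuous_const.intervalIntegrable _ _) ?_
    · filter_upwards [hev] with s hs
      simp only [slope_def_field]
      exact (((hcont s ⟨ht.1.le.trans hs.1.le, hs.2.le⟩).sub
        (hcont t htc)).div_const _).aestronglyMeasurable
    · filter_upwards [hev] with s hs
      refine Eventually.of_forall fun x hx => ?_
      rw [uIoc_of_le hL.le] at hx
      have hx' : x ∈ Icc 0 L := ⟨hx.1.le, hx.2⟩
      have a1 := hM₁ s ⟨hs.1.le, hs.2⟩ x hx'
      have a2 := hM₂ s ⟨hs.1.le, hs.2⟩ x hx'
      have hst : 0 < s - t := sub_pos.2 hs.1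
      rw [slope_def_field, norm_eq_abs, abs_div, abs_of_pos hst, div_le_iff₀ hst]
      calc |(|u s x - v s x| - |u t x - v t x|)|
          ≤ |(u s x - v s x) - (u t x - v t x)| := abs_abs_sub_abs_le_abs_sub _ _
        _ = |(u s x - u t x) - (v s x - v t x)| := by ring_nf
        _ ≤ |u s x - u t x| + |v s x - v t x| := abs_sub _ _
        _ ≤ (M₁ + M₂) * (s - t) := by linarith
    · have hdf : ∀ x, HasDerivAt (fun y => u t y - v t y) (deriv (u t) x - deriv (v t) x) x :=
        fun x => (hf.differentiable two_ne_zero x).hasDerivAt.sub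
          (hg.differentiable two_ne_zero x).hasDerivAt
      have hdP : ∀ x, HasDerivAt (fun y => flux κ H (u t) y - flux κ H (v t) y)
          (deriv (flux κ H (u t)) x - deriv (flux κ H (v t)) x) x := fun x =>
        ((contDiff_flux hκ hH hf).differentiable one_ne_zero x).hasDerivAt.sub
          ((contDiff_flux hκ hH hg).differentiable one_ne_zero x).hasDerivAt
      filter_upwards [ae_hasDerivAt_eq_zero_of_eq_zero (fun y => u t y - v t y),
        ae_hasDerivAt_eq_zero_of_eq_zero (fun y => flux κ H (u t) y - flux κ H (v t) y)]
        with x h1 h2 _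
      have hd : HasDerivAt (fun s => |u s x - v s x|) _ t :=
        ((hu.hasDerivAt ht x).sub (hv.hasDerivAt ht x)).abs_of_eq_zero_imp fun h0 => by
          have h3 := h1 h0 _ (hdf x)
          refine h2 ?_ _ (hdP x)
          simp only [flux, sub_eq_zero.1 h0, sub_eq_zero.1 h3, sub_self]
      exact (hasDerivAt_iff_tendsto_slope.1 hd).mono_left
        (nhdsWithin_mono _ fun r hr => (ne_of_gt hr : r ≠ t))
  refine hlim.congr' ?_
  filter_upwards [hev] with s hs
  simp only [slope_def_field]
  rw [intervalIntegral.integral_div, intervalIntegral.integral_sub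
    ((hcont s ⟨ht.1.le.trans hs.1.le, hs.2.le⟩).intervalIntegrable _ _)
    ((hcont t htc).intervalIntegrable _ _)]

end Solution

/-- `L¹`-contraction on the torus: the `L¹` distance over one period between two
classical `L`-periodic solutions is non-increasing in time. -/
theorem L1_contraction
    (κ H : ℝ → ℝ) (κ₀ C_κ C_H q L T : ℝ) (hκ₀ : κ₀ ∈ Ioc (0:ℝ) 1)
    (hκb : ∀ s : ℝ, κ₀ ≤ κ s ∧ κ s ≤ κ₀⁻¹) (hκ : ContDiff ℝ 1 κ)
    (hκ' : ∀ s : ℝ, |deriv κ s| ≤ C_κ * (1 + |s|))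
    (hH : ContDiff ℝ 1 H) (hCH : 0 < C_H) (hq : q ∈ Ioc (1:ℝ) 2)
    (hH' : ∀ s : ℝ, |deriv H s| ≤ C_H * (1 + |s|) ^ (q / 2))
    (hL : 0 < L) (hT : 0 < T)
    (u v : ℝ → ℝ → ℝ)
    (hu : IsClassicalPeriodicSol κ H L T u) (hv : IsClassicalPeriodicSol κ H L T v) :
    ∀ t ∈ Icc (0:ℝ) T,
      (∫ x in (0:ℝ)..L, |u t x - v t x|) ≤ ∫ x in (0:ℝ)..L, |u 0 x - v 0 x| := by
  intro t ht
  have hcont := continuousOn_integral_abs_sub hT.le hu hv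
  set F : ℝ → ℝ := fun t => ∫ x in (0:ℝ)..L, |u t x - v t x|
  rcases ht.1.eq_or_lt with h0 | h0
  · rw [← h0]
  have hdec : ∀ a ∈ Ioc 0 t, F t ≤ F a := by
    intro a ha
    refine image_le_of_liminf_slope_right_le_deriv_boundary (f := F) (a := a) (b := t)
      (B := fun _ => F a) (B' := fun _ => 0) (hcont.mono (Icc_subset_Icc ha.1.le ht.2)) le_rfl
      continuousOn_const (fun x _ => hasDerivWithinAt_const _ _ _) ?_ ⟨ha.2, le_rfl⟩
    intro x hx r hr
    obtain ⟨d, hd, hderiv⟩ := exists_hasDerivWithinAt_integral_abs_sub hκ₀.1 hκb hκ hH hL hu hv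
      (t := x) ⟨ha.1.trans_le hx.1, hx.2.trans_le ht.2⟩
    exact hderiv.liminf_right_slope_le (hd.trans_lt hr)
  have hlim : Tendsto F (𝓝[>] 0) (𝓝 (F 0)) :=
    (hcont 0 ⟨le_rfl, hT.le⟩).mono_left <| by
      rw [← nhdsWithin_Ioo_eq_nhdsGT hT]
      exact nhdsWithin_mono _ Ioo_subset_Icc_self
  exact ge_of_tendsto hlim (by filter_upwards [Ioc_mem_nhdsGT h0] with a ha using hdec a ha)
end
end

section
/- (Gaussian supersolution.) Fix κ₀ ∈ (0,1] and set a := κ₀²/2 and b := κ₀/4. Define ψ(t,x) := t^{−a} exp(−b x²/t) for t > 0 and x ∈ ℝ. Then for every κ ∈ [κ₀, κ₀⁻¹], every t > 0, and every x ∈ ℝ, one has ∂_t ψ(t,x) − κ ∂_x² ψ(t,x) ≥ 0. -/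
open Real Set

noncomputable section

/-- The Gaussian-type supersolution `ψ(t,x) = t^{−a} exp(−b x²/t)` with
`a = κ₀²/2` and `b = κ₀/4`. -/
def gaussPsi (κ₀ t x : ℝ) : ℝ :=
  t ^ (-(κ₀ ^ 2 / 2)) * Real.exp (-(κ₀ / 4) * x ^ 2 / t)

theorem hasDerivAt_gaussPsi_time (κ₀ x : ℝ) {t : ℝ} (ht : 0 < t) :
    HasDerivAt (fun s => gaussPsi κ₀ s x)
      (gaussPsi κ₀ t x * (-(κ₀ ^ 2 / 2) / t + κ₀ / 4 * x ^ 2 / t ^ 2)) t := by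
  have hpow := Real.hasDerivAt_rpow_const (x := t) (p := -(κ₀ ^ 2 / 2)) (Or.inl ht.ne')
  have hexp := ((hasDerivAt_const t (-(κ₀ / 4) * x ^ 2)).fun_div (hasDerivAt_id' t) ht.ne').exp
  refine (hpow.fun_mul hexp).congr_deriv ?_
  rw [Real.rpow_sub_one ht.ne', gaussPsi]
  field_simp
  ring

theorem hasDerivAt_gaussPsi_space (κ₀ t x : ℝ) :
    HasDerivAt (fun y => gaussPsi κ₀ t y)
      (gaussPsi κ₀ t x * (-(κ₀ / 2) * x / t)) x := by
  have hexp := ((((hasDerivAt_id' x).fun_pow 2).const_mul (-(κ₀ / 4))).div_const t).exp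
  refine (hexp.const_mul (t ^ (-(κ₀ ^ 2 / 2)))).congr_deriv ?_
  rw [gaussPsi]
  push_cast
  ring

theorem hasDerivAt_deriv_gaussPsi_space (κ₀ t x : ℝ) :
    HasDerivAt (fun y => deriv (fun z => gaussPsi κ₀ t z) y)
      (gaussPsi κ₀ t x * (κ₀ ^ 2 / 4 * x ^ 2 / t ^ 2 - κ₀ / 2 / t)) x := by
  have hderiv : (fun y => deriv (fun z => gaussPsi κ₀ t z) y) =
      fun y => gaussPsi κ₀ t y * (-(κ₀ / 2) * y / t) :=
    funext fun y => (hasDerivAt_gaussPsi_space κ₀ t y).deriv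
  rw [hderiv]
  have hlin := ((hasDerivAt_id' x).const_mul (-(κ₀ / 2))).div_const t
  refine ((hasDerivAt_gaussPsi_space κ₀ t x).fun_mul hlin).congr_deriv ?_
  ring

/-- Gaussian supersolution: for every `κ ∈ [κ₀, κ₀⁻¹]`, `t > 0`, and `x ∈ ℝ`,
`∂ₜψ − κ ∂ₓ²ψ ≥ 0`. -/
theorem gaussian_supersolution
    (κ₀ : ℝ) (hκ₀ : κ₀ ∈ Ioc (0:ℝ) 1)
    (κ : ℝ) (hκ : κ ∈ Icc κ₀ κ₀⁻¹) (t x : ℝ) (ht : 0 < t) :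
    0 ≤ deriv (fun s => gaussPsi κ₀ s x) t -
        κ * deriv (fun y => deriv (fun z => gaussPsi κ₀ t z) y) x := by
  obtain ⟨hpos, -⟩ := hκ₀
  obtain ⟨hlower, hupper⟩ := hκ
  have hmul : κ * κ₀ ≤ 1 := by
    simpa [hpos.ne'] using mul_le_mul_of_nonneg_right hupper hpos.le
  rw [(hasDerivAt_gaussPsi_time κ₀ x ht).deriv, (hasDerivAt_deriv_gaussPsi_space κ₀ t x).deriv]
  have hψ : 0 ≤ gaussPsi κ₀ t x := by
    unfold gaussPsi
    positivity
  have hsplit : gaussPsi κ₀ t x * (-(κ₀ ^ 2 / 2) / t + κ₀ / 4 * x ^ 2 / t ^ 2) -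
      κ * (gaussPsi κ₀ t x * (κ₀ ^ 2 / 4 * x ^ 2 / t ^ 2 - κ₀ / 2 / t)) =
      gaussPsi κ₀ t x *
        (κ₀ / 2 * (κ - κ₀) / t + κ₀ / 4 * (1 - κ * κ₀) * (x ^ 2 / t ^ 2)) := by
    ring
  rw [hsplit]
  have hlower' : 0 ≤ κ - κ₀ := sub_nonneg.mpr hlower
  have hmul' : 0 ≤ 1 - κ * κ₀ := sub_nonneg.mpr hmul
  positivity
end
end

section
/- (Existence of a smooth convex approximation of the absolute value.) There exist a constant C > 0 and a family (F_ε)_{ε∈(0,1]} of convex C² functions F_ε : ℝ → ℝ such that: (i) F_ε(x) = |x| whenever |x| ≥ 1; (ii) sup_{x∈ℝ} |F_ε(x) − |x|| → 0 as ε → 0; (iii) for all ε ∈ (0,1] and x ∈ ℝ, F_ε(x) ≤ C(|x| + ε), |x F_ε'(x)| ≤ C F_ε(x), |F_ε'(x)| ≤ C, and |x| F_ε''(x) ≤ C·1_{[−ε,ε]}(x); and (iv) for every w ∈ ℝ, F_ε'(w) → sgn(w) as ε → 0, with the convention sgn(0) = 0. -/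
open Real Set Filter

noncomputable section

theorem hasDerivAt_max_zero_pow (n : ℕ) (a x : ℝ) :
    HasDerivAt (fun y : ℝ => max (y - a) 0 ^ (n + 2)) ((n + 2) * max (x - a) 0 ^ (n + 1)) x := by
  have hpow : HasDerivAt (fun y : ℝ => (y - a) ^ (n + 2)) ((n + 2) * (x - a) ^ (n + 1)) x := by
    simpa using ((hasDerivAt_id x).sub_const a).fun_pow (n + 2)
  have right : a ≤ x → HasDerivWithinAt (fun y : ℝ => max (y - a) 0 ^ (n + 2))
      ((n + 2) * max (x - a) 0 ^ (n + 1)) (Ici a) x := fun h => by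
    rw [max_eq_left (sub_nonneg.2 h)]
    refine hpow.hasDerivWithinAt.congr (fun y hy => ?_) ?_
    · rw [max_eq_left (sub_nonneg.2 hy)]
    · rw [max_eq_left (sub_nonneg.2 h)]
  have left : x ≤ a → HasDerivWithinAt (fun y : ℝ => max (y - a) 0 ^ (n + 2))
      ((n + 2) * max (x - a) 0 ^ (n + 1)) (Iic a) x := fun h => by
    rw [max_eq_right (sub_nonpos.2 h), zero_pow n.succ_ne_zero, mul_zero]
    refine (hasDerivWithinAt_const x (Iic a) (0 : ℝ)).congr (fun y hy => ?_) ?_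
    · rw [max_eq_right (sub_nonpos.2 hy), zero_pow (by lia)]
    · rw [max_eq_right (sub_nonpos.2 h), zero_pow (by lia)]
  rcases lt_trichotomy x a with h | rfl | h
  · exact (left h.le).hasDerivAt (Iic_mem_nhds h)
  · have := (left le_rfl).union (right le_rfl)
    rwa [Iic_union_Ici, hasDerivWithinAt_univ] at this
  · exact (right h.le).hasDerivAt (Ici_mem_nhds h)

/-- A convex `C²` function equal to `|x|` for `1 ≤ |x|` and to `3/8 + 3x²/4 - x⁴/8`
on `[-1, 1]`, written in terms of truncated powers. -/
def smoothAbs (x : ℝ) : ℝ :=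
  -x + max (x - -1) 0 ^ 3 / 2 - max (x - -1) 0 ^ 4 / 8
    + max (x - 1) 0 ^ 3 / 2 + max (x - 1) 0 ^ 4 / 8

/-- The derivative of `smoothAbs`. -/
def smoothAbsDeriv (x : ℝ) : ℝ :=
  -1 + 3 / 2 * max (x - -1) 0 ^ 2 - max (x - -1) 0 ^ 3 / 2
    + 3 / 2 * max (x - 1) 0 ^ 2 + max (x - 1) 0 ^ 3 / 2

/-- The second derivative of `smoothAbs`. -/
def smoothAbsDeriv2 (x : ℝ) : ℝ :=
  3 * max (x - -1) 0 - 3 / 2 * max (x - -1) 0 ^ 2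
    + 3 * max (x - 1) 0 + 3 / 2 * max (x - 1) 0 ^ 2

theorem hasDerivAt_smoothAbs (x : ℝ) : HasDerivAt smoothAbs (smoothAbsDeriv x) x := by
  have h := (((((hasDerivAt_id x).neg.add
    ((hasDerivAt_max_zero_pow 1 (-1) x).div_const 2)).sub
    ((hasDerivAt_max_zero_pow 2 (-1) x).div_const 8)).add
    ((hasDerivAt_max_zero_pow 1 1 x).div_const 2)).add
    ((hasDerivAt_max_zero_pow 2 1 x).div_const 8))
  refine h.congr_deriv ?_
  simp only [smoothAbsDeriv]
  norm_num
  ring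

theorem hasDerivAt_smoothAbsDeriv (x : ℝ) :
    HasDerivAt smoothAbsDeriv (smoothAbsDeriv2 x) x := by
  have h := (((((hasDerivAt_const x (-1 : ℝ)).add
    ((hasDerivAt_max_zero_pow 0 (-1) x).const_mul (3 / 2))).sub
    ((hasDerivAt_max_zero_pow 1 (-1) x).div_const 2)).add
    ((hasDerivAt_max_zero_pow 0 1 x).const_mul (3 / 2))).add
    ((hasDerivAt_max_zero_pow 1 1 x).div_const 2))
  refine h.congr_deriv ?_
  simp only [smoothAbsDeriv2]
  norm_num
  ring

theorem continuous_smoothAbsDeriv2 : Continuous smoothAbsDeriv2 := by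
  unfold smoothAbsDeriv2
  fun_prop

section Values

variable {x : ℝ}

theorem smoothAbs_values_of_le (h : x ≤ -1) :
    smoothAbs x = -x ∧ smoothAbsDeriv x = -1 ∧ smoothAbsDeriv2 x = 0 := by
  have h₁ : max (x - -1) 0 = 0 := max_eq_right (by linarith)
  have h₂ : max (x - 1) 0 = 0 := max_eq_right (by linarith)
  simp [smoothAbs, smoothAbsDeriv, smoothAbsDeriv2, h₁, h₂, -sub_neg_eq_add]

theorem smoothAbs_values_of_ge (h : 1 ≤ x) :
    smoothAbs x = x ∧ smoothAbsDeriv x = 1 ∧ smoothAbsDeriv2 x = 0 := by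
  have h₁ : max (x - -1) 0 = x - -1 := max_eq_left (by linarith)
  have h₂ : max (x - 1) 0 = x - 1 := max_eq_left (by linarith)
  simp only [smoothAbs, smoothAbsDeriv, smoothAbsDeriv2, h₁, h₂]
  refine ⟨?_, ?_, ?_⟩ <;> ring

theorem smoothAbs_values_of_abs_le (h : |x| ≤ 1) :
    smoothAbs x = 3 / 8 + 3 / 4 * x ^ 2 - x ^ 4 / 8 ∧
      smoothAbsDeriv x = (3 * x - x ^ 3) / 2 ∧ smoothAbsDeriv2 x = 3 / 2 * (1 - x ^ 2) := by
  obtain ⟨h', h''⟩ := abs_le.1 h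
  have h₁ : max (x - -1) 0 = x - -1 := max_eq_left (by linarith)
  have h₂ : max (x - 1) 0 = 0 := max_eq_right (by linarith)
  simp only [smoothAbs, smoothAbsDeriv, smoothAbsDeriv2, h₁, h₂]
  refine ⟨?_, ?_, ?_⟩ <;> ring

theorem smoothAbs_values_of_one_le_abs (h : 1 ≤ |x|) :
    smoothAbs x = |x| ∧ smoothAbsDeriv x = Real.sign x ∧ smoothAbsDeriv2 x = 0 := by
  rcases le_abs'.1 h with h | h
  · rw [abs_of_neg (by linarith), Real.sign_of_neg (by linarith)]
    exact smoothAbs_values_of_le h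
  · rw [abs_of_pos (by linarith), Real.sign_of_pos (by linarith)]
    exact smoothAbs_values_of_ge h

end Values

theorem abs_le_smoothAbs (x : ℝ) : |x| ≤ smoothAbs x := by
  rcases le_total |x| 1 with h | h
  · rw [(smoothAbs_values_of_abs_le h).1, ← sq_abs, ← Even.pow_abs (by decide : Even 4)]
    have h₀ := abs_nonneg x
    have : 0 ≤ (1 - |x|) ^ 3 * (|x| + 3) := by
      have := sub_nonneg.2 h
      positivity
    nlinarith
  · exact (smoothAbs_values_of_one_le_abs h).1.ge

theorem smoothAbs_le (x : ℝ) : smoothAbs x ≤ |x| + 1 := by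
  rcases le_total |x| 1 with h | h
  · rw [(smoothAbs_values_of_abs_le h).1, ← sq_abs, ← Even.pow_abs (by decide : Even 4)]
    have h₀ := abs_nonneg x
    nlinarith [pow_nonneg h₀ 4]
  · linarith [(smoothAbs_values_of_one_le_abs h).1]

theorem smoothAbsDeriv2_nonneg (x : ℝ) : 0 ≤ smoothAbsDeriv2 x := by
  rcases le_total |x| 1 with h | h
  · rw [(smoothAbs_values_of_abs_le h).2.2]
    nlinarith [(sq_le_one_iff_abs_le_one x).2 h]
  · exact (smoothAbs_values_of_one_le_abs h).2.2.ge

theorem abs_smoothAbsDeriv_le_one (x : ℝ) : |smoothAbsDeriv x| ≤ 1 := by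
  have hmono : Monotone smoothAbsDeriv :=
    monotone_of_hasDerivAt_nonneg hasDerivAt_smoothAbsDeriv smoothAbsDeriv2_nonneg
  refine abs_le.2 ⟨?_, ?_⟩
  · rw [← (smoothAbs_values_of_le (min_le_right x (-1))).2.1]
    exact hmono (min_le_left _ _)
  · rw [← (smoothAbs_values_of_ge (le_max_right x 1)).2.1]
    exact hmono (le_max_left _ _)

theorem contDiff_two_of_hasDerivAt {f f' f'' : ℝ → ℝ} (hf : ∀ x, HasDerivAt f (f' x) x)
    (hf' : ∀ x, HasDerivAt f' (f'' x) x) (hc : Continuous f'') : ContDiff ℝ 2 f := by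
  have h' : deriv f = f' := funext fun x => (hf x).deriv
  have h'' : deriv f' = f'' := funext fun x => (hf' x).deriv
  rw [show (2 : WithTop ℕ∞) = 1 + 1 by norm_num, contDiff_succ_iff_deriv, h',
    contDiff_one_iff_deriv, h'']
  exact ⟨fun x => (hf x).differentiableAt, by simp, fun x => (hf' x).differentiableAt, hc⟩

/-- The rescaling `ε φ(x / ε)` of `φ = smoothAbs`. -/
def scaledSmoothAbs (ε x : ℝ) : ℝ := ε * smoothAbs (x / ε)

section Scaled

variable {ε : ℝ}

theorem hasDerivAt_scaledSmoothAbs (hε : 0 < ε) (x : ℝ) :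
    HasDerivAt (scaledSmoothAbs ε) (smoothAbsDeriv (x / ε)) x := by
  refine (((hasDerivAt_smoothAbs (x / ε)).comp x
    ((hasDerivAt_id x).div_const ε)).const_mul ε).congr_deriv ?_
  field_simp

theorem hasDerivAt_smoothAbsDeriv_div (ε x : ℝ) :
    HasDerivAt (fun y => smoothAbsDeriv (y / ε)) (smoothAbsDeriv2 (x / ε) / ε) x := by
  refine ((hasDerivAt_smoothAbsDeriv (x / ε)).comp x
    ((hasDerivAt_id x).div_const ε)).congr_deriv ?_
  ring

theorem deriv_scaledSmoothAbs (hε : 0 < ε) :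
    deriv (scaledSmoothAbs ε) = fun y => smoothAbsDeriv (y / ε) :=
  funext fun x => (hasDerivAt_scaledSmoothAbs hε x).deriv

theorem deriv_deriv_scaledSmoothAbs (hε : 0 < ε) :
    deriv (deriv (scaledSmoothAbs ε)) = fun y => smoothAbsDeriv2 (y / ε) / ε := by
  rw [deriv_scaledSmoothAbs hε]
  exact funext fun x => (hasDerivAt_smoothAbsDeriv_div ε x).deriv

theorem contDiff_scaledSmoothAbs (hε : 0 < ε) : ContDiff ℝ 2 (scaledSmoothAbs ε) :=
  contDiff_two_of_hasDerivAt (hasDerivAt_scaledSmoothAbs hε)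
    (hasDerivAt_smoothAbsDeriv_div ε)
    ((continuous_smoothAbsDeriv2.comp (continuous_id.div_const ε)).div_const ε)

theorem convexOn_scaledSmoothAbs (hε : 0 < ε) : ConvexOn ℝ univ (scaledSmoothAbs ε) := by
  refine MonotoneOn.convexOn_of_deriv convex_univ
    (contDiff_scaledSmoothAbs hε).continuous.continuousOn
    (fun x _ => (hasDerivAt_scaledSmoothAbs hε x).differentiableAt.differentiableWithinAt) ?_
  rw [deriv_scaledSmoothAbs hε]
  exact (monotone_of_hasDerivAt_nonneg (hasDerivAt_smoothAbsDeriv_div ε)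
    fun x => div_nonneg (smoothAbsDeriv2_nonneg _) hε.le).monotoneOn _

theorem mul_abs_div_self (hε : 0 < ε) (x : ℝ) : ε * |x / ε| = |x| := by
  rw [abs_div, abs_of_pos hε, mul_div_cancel₀ _ hε.ne']

theorem scaledSmoothAbs_eq_abs (hε : 0 < ε) {x : ℝ} (hx : ε ≤ |x|) :
    scaledSmoothAbs ε x = |x| := by
  rw [scaledSmoothAbs, (smoothAbs_values_of_one_le_abs _).1, mul_abs_div_self hε]
  rwa [abs_div, abs_of_pos hε, one_le_div hε]

theorem abs_le_scaledSmoothAbs (hε : 0 < ε) (x : ℝ) : |x| ≤ scaledSmoothAbs ε x := by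
  rw [← mul_abs_div_self hε x]
  exact mul_le_mul_of_nonneg_left (abs_le_smoothAbs _) hε.le

theorem scaledSmoothAbs_le (hε : 0 < ε) (x : ℝ) : scaledSmoothAbs ε x ≤ |x| + ε := by
  have h := mul_le_mul_of_nonneg_left (smoothAbs_le (x / ε)) hε.le
  rwa [mul_add, mul_abs_div_self hε, mul_one] at h

theorem abs_mul_deriv_deriv_scaledSmoothAbs_le (hε : 0 < ε) (x : ℝ) :
    |x| * deriv (deriv (scaledSmoothAbs ε)) x ≤
      2 * Set.indicator (Icc (-ε) ε) (fun _ => (1 : ℝ)) x := by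
  have hscale : |x| * deriv (deriv (scaledSmoothAbs ε)) x =
      |x / ε| * smoothAbsDeriv2 (x / ε) := by
    rw [deriv_deriv_scaledSmoothAbs hε, abs_div, abs_of_pos hε]
    ring
  have hdiv : |x / ε| = |x| / ε := by rw [abs_div, abs_of_pos hε]
  rw [hscale]
  by_cases hx : x ∈ Icc (-ε) ε
  · have h : |x / ε| ≤ 1 := by
      rw [hdiv, div_le_one hε]
      exact abs_le.2 hx
    rw [indicator_of_mem hx, (smoothAbs_values_of_abs_le h).2.2, ← sq_abs]
    have h₀ := abs_nonneg (x / ε)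
    nlinarith [pow_nonneg h₀ 3]
  · have h : 1 ≤ |x / ε| := by
      rw [hdiv, one_le_div hε]
      exact (not_le.1 fun h => hx (abs_le.1 h)).le
    rw [indicator_of_notMem hx, (smoothAbs_values_of_one_le_abs h).2.2]
    simp

end Scaled

theorem tendsto_iSup_scaledSmoothAbs_sub_abs :
    Tendsto (fun ε : ℝ => ⨆ x : ℝ, abs (scaledSmoothAbs ε x - |x|))
      (nhdsWithin 0 (Ioi 0)) (nhds 0) := by
  refine tendsto_of_tendsto_of_tendsto_of_le_of_le' tendsto_const_nhds
    (tendsto_id.mono_left nhdsWithin_le_nhds) ?_ ?_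
  · exact .of_forall fun ε => Real.iSup_nonneg fun x => abs_nonneg _
  · filter_upwards [self_mem_nhdsWithin] with ε hε
    refine ciSup_le fun x => ?_
    rw [abs_of_nonneg (sub_nonneg.2 (abs_le_scaledSmoothAbs hε x))]
    exact sub_left_le_of_le_add (scaledSmoothAbs_le hε x)

theorem tendsto_deriv_scaledSmoothAbs (w : ℝ) :
    Tendsto (fun ε : ℝ => deriv (scaledSmoothAbs ε) w) (nhdsWithin 0 (Ioi 0))
      (nhds (Real.sign w)) := by
  refine tendsto_const_nhds.congr' ?_
  rcases eq_or_ne w 0 with rfl | hw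
  · filter_upwards [self_mem_nhdsWithin] with ε hε
    rw [deriv_scaledSmoothAbs hε]
    simp [(smoothAbs_values_of_abs_le (x := 0) (by simp)).2.1]
  · filter_upwards [Ioo_mem_nhdsGT (abs_pos.2 hw)] with ε hε
    rw [(hasDerivAt_scaledSmoothAbs hε.1 w).deriv, (smoothAbs_values_of_one_le_abs _).2.1]
    · rcases hw.lt_or_gt with h | h
      · rw [Real.sign_of_neg h, Real.sign_of_neg (div_neg_of_neg_of_pos h hε.1)]
      · rw [Real.sign_of_pos h, Real.sign_of_pos (div_pos h hε.1)]
    · rw [abs_div, abs_of_pos hε.1, one_le_div hε.1]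
      exact hε.2.le

/-- Existence of a smooth convex approximation `(F_ε)_{ε ∈ (0,1]}` of the absolute
value, with uniform structural bounds, agreeing with `|·|` outside `[-1,1]`, converging
uniformly to `|·|`, and with `F_ε' → sgn` pointwise as `ε → 0`. -/
theorem convex_approx_abs :
    ∃ (C : ℝ) (F : ℝ → ℝ → ℝ), 0 < C ∧
      (∀ ε ∈ Ioc (0:ℝ) 1,
        ConvexOn ℝ univ (F ε) ∧
        ContDiff ℝ 2 (F ε) ∧
        (∀ x : ℝ, 1 ≤ |x| → F ε x = |x|) ∧
        (∀ x : ℝ, F ε x ≤ C * (|x| + ε)) ∧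
        (∀ x : ℝ, |x * deriv (F ε) x| ≤ C * F ε x) ∧
        (∀ x : ℝ, |deriv (F ε) x| ≤ C) ∧
        (∀ x : ℝ, |x| * deriv (deriv (F ε)) x ≤
          C * Set.indicator (Icc (-ε) ε) (fun _ => (1:ℝ)) x)) ∧
      Tendsto (fun ε : ℝ => ⨆ x : ℝ, abs (F ε x - |x|)) (nhdsWithin 0 (Ioi 0)) (nhds 0) ∧
      (∀ w : ℝ,
        Tendsto (fun ε : ℝ => deriv (F ε) w) (nhdsWithin 0 (Ioi 0))
          (nhds (Real.sign w))) := by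
  refine ⟨2, scaledSmoothAbs, two_pos, fun ε hε => ?_,
    tendsto_iSup_scaledSmoothAbs_sub_abs, tendsto_deriv_scaledSmoothAbs⟩
  obtain ⟨h₀, h₁⟩ := hε
  refine ⟨convexOn_scaledSmoothAbs h₀, contDiff_scaledSmoothAbs h₀,
    fun x hx => scaledSmoothAbs_eq_abs h₀ (h₁.trans hx), fun x => ?_, fun x => ?_, fun x => ?_,
    abs_mul_deriv_deriv_scaledSmoothAbs_le h₀⟩
  · linarith [scaledSmoothAbs_le h₀ x, abs_nonneg x]
  · rw [(hasDerivAt_scaledSmoothAbs h₀ x).deriv, abs_mul]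
    linarith [mul_le_of_le_one_right (abs_nonneg x) (abs_smoothAbsDeriv_le_one (x / ε)),
      abs_le_scaledSmoothAbs h₀ x, abs_nonneg x]
  · rw [(hasDerivAt_scaledSmoothAbs h₀ x).deriv]
    linarith [abs_smoothAbsDeriv_le_one (x / ε)]
end
end

section
/- (Moment bound for the weighted Hölder norm of a random field.) Fix q ∈ (1,2], β ∈ (2/(2+q), 1), γ ∈ (0,1/2], and C₀ > 0. There exists a constant C, depending only on q, β, γ, and C₀, such that the following holds. Let (Ω,F,P) be a probability space, a ∈ ℝ, and let v : Ω×ℝ → ℝ be jointly measurable and almost surely continuously differentiable in x, with E|v(x) − a|^q ≤ C₀⟨a⟩² and E|∂_x v(x)|² ≤ C₀ for every x ∈ ℝ, where ⟨a⟩ := √(4+a²). Then E‖v‖_{C^γ_{p_β}}^q ≤ C⟨a⟩², where ‖f‖_{C^γ_{p_β}} := sup_{x∈ℝ} |f(x)|/⟨x⟩^β + sup_{0<|x−y|≤1} |f(x)−f(y)|/(⟨x⟩^β |x−y|^γ) and ⟨x⟩ := √(4+x²). -/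
open Real Set MeasureTheory

noncomputable section

/-- The Japanese bracket `⟨x⟩ = √(4 + x²)`. -/
def jbr (x : ℝ) : ℝ := Real.sqrt (4 + x ^ 2)

/-- The weighted Hölder norm
`‖f‖_{C^γ_{p_β}} = sup_x |f x|/⟨x⟩^β + sup_{0<|x−y|≤1} |f x − f y|/(⟨x⟩^β |x−y|^γ)`. -/
def whnorm (β γ : ℝ) (f : ℝ → ℝ) : ℝ :=
  (⨆ x : ℝ, |f x| / jbr x ^ β) +
    ⨆ p : {p : ℝ × ℝ // p.1 ≠ p.2 ∧ |p.1 - p.2| ≤ 1},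
      |f p.1.1 - f p.1.2| / (jbr p.1.1 ^ β * |p.1.1 - p.1.2| ^ γ)

theorem two_le_jbr (x : ℝ) : 2 ≤ jbr x :=
  Real.le_sqrt_of_sq_le (by nlinarith [sq_nonneg x])

theorem abs_le_jbr (x : ℝ) : |x| ≤ jbr x :=
  Real.abs_le_sqrt (by linarith)

theorem jbr_sq (x : ℝ) : jbr x ^ 2 = 4 + x ^ 2 :=
  Real.sq_sqrt (by positivity)

theorem continuous_jbr : Continuous jbr := by
  unfold jbr
  fun_prop

theorem continuous_jbr_rpow (r : ℝ) : Continuous fun x => jbr x ^ r :=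
  continuous_jbr.rpow_const fun x => Or.inl (by linarith [two_le_jbr x])

theorem jbr_le_two_mul {x y : ℝ} (h : |y - x| ≤ jbr x) : jbr y ≤ 2 * jbr x := by
  have hx := two_le_jbr x
  refine Real.sqrt_le_iff.2 ⟨by linarith, ?_⟩
  have h2 : (y - x) ^ 2 ≤ jbr x ^ 2 := sq_le_sq' (by linarith [neg_abs_le (y - x)])
    ((le_abs_self _).trans h)
  rw [mul_pow, jbr_sq]
  rw [jbr_sq] at h2
  nlinarith [sq_nonneg (y - 2 * x)]

theorem integrable_jbr_rpow_neg {s : ℝ} (hs : 1 < s) : Integrable fun x => jbr x ^ (-s) := by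
  have h := integrable_rpow_neg_one_add_norm_sq (E := ℝ) (μ := volume) (r := s) (by simpa using hs)
  refine h.mono' (continuous_jbr_rpow _).aestronglyMeasurable (ae_of_all _ fun x => ?_)
  have hx := two_le_jbr x
  rw [Real.norm_of_nonneg (by positivity), jbr, Real.sqrt_eq_rpow, ← Real.rpow_mul (by positivity)]
  rw [show 1 / 2 * -s = -s / 2 by ring]
  refine Real.rpow_le_rpow_of_nonpos (by positivity) ?_ (by linarith)
  simp only [Real.norm_eq_abs, sq_abs]
  linarith

/-- On an interval where the bracket is at most `2⟨x⟩`, an integral is controlled by the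
weighted integral over the line. -/
theorem intervalIntegral_le_weighted {h : ℝ → ℝ} (hc : Continuous h) (h0 : ∀ y, 0 ≤ h y)
    {s : ℝ} (hs0 : 0 ≤ s) (hs2 : s ≤ 2) (hi : Integrable fun y => h y * jbr y ^ (-s))
    {u w x : ℝ} (huw : u ≤ w) (hx : ∀ y ∈ Icc u w, jbr y ≤ 2 * jbr x) :
    ∫ y in u..w, h y ≤ 4 * jbr x ^ s * ∫ y, h y * jbr y ^ (-s) := by
  have hx2 := two_le_jbr x
  calc ∫ y in u..w, h y ≤ ∫ y in u..w, 4 * jbr x ^ s * (h y * jbr y ^ (-s)) := by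
        refine intervalIntegral.integral_mono_on huw (hc.intervalIntegrable _ _)
          ((continuous_const.mul (hc.mul (continuous_jbr_rpow _))).intervalIntegrable _ _) ?_
        intro y hy
        have hy2 := two_le_jbr y
        have hp : 0 < jbr y ^ s := by positivity
        have h1 : jbr y ^ s ≤ 4 * jbr x ^ s :=
          calc jbr y ^ s ≤ (2 * jbr x) ^ s := Real.rpow_le_rpow (by linarith) (hx y hy) hs0
            _ = 2 ^ s * jbr x ^ s := Real.mul_rpow (by norm_num) (by linarith)
            _ ≤ 4 * jbr x ^ s := by
                gcongr
                calc (2:ℝ) ^ s ≤ 2 ^ (2:ℝ) := Real.rpow_le_rpow_of_exponent_le (by norm_num) hs2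
                  _ = 4 := by norm_num
        rw [Real.rpow_neg (by linarith), ← div_eq_mul_inv, ← mul_div_assoc, le_div_iff₀ hp,
          mul_comm]
        exact mul_le_mul_of_nonneg_right h1 (h0 y)
    _ = 4 * jbr x ^ s * ∫ y in u..w, h y * jbr y ^ (-s) :=
        intervalIntegral.integral_const_mul _ _
    _ ≤ _ := by
        rw [intervalIntegral.integral_of_le huw]
        refine mul_le_mul_of_nonneg_left (setIntegral_le_integral hi (ae_of_all _ fun y => ?_))
          (by positivity)
        have hy2 := two_le_jbr y
        exact mul_nonneg (h0 y) (by positivity)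

/-- Cauchy–Schwarz for the increments of a `C¹` function. -/
theorem sq_sub_le_mul_integral_deriv_sq {f : ℝ → ℝ} (hf : ContDiff ℝ 1 f) {x y : ℝ} (hxy : x ≤ y) :
    (f y - f x) ^ 2 ≤ (y - x) * ∫ t in x..y, deriv f t ^ 2 := by
  rcases hxy.eq_or_lt with rfl | hlt
  · simp
  have hd : Continuous (deriv f) := hf.continuous_deriv le_rfl
  have hftc : ∫ t in x..y, deriv f t = f y - f x :=
    intervalIntegral.integral_deriv_eq_sub
      (fun t _ => (hf.differentiable one_ne_zero) t) (hd.intervalIntegrable _ _)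
  set c := (f y - f x) / (y - x) with hc
  have hcd : c * (y - x) = f y - f x := div_mul_cancel₀ _ (by linarith)
  have h0 : 0 ≤ ∫ t in x..y, (deriv f t ^ 2 - (2 * c) * deriv f t + c ^ 2) :=
    intervalIntegral.integral_nonneg hxy fun t _ => by nlinarith [sq_nonneg (deriv f t - c)]
  rw [intervalIntegral.integral_add (Continuous.intervalIntegrable (by fun_prop) _ _)
      (Continuous.intervalIntegrable (by fun_prop) _ _),
    intervalIntegral.integral_sub (Continuous.intervalIntegrable (by fun_prop) _ _)
      (Continuous.intervalIntegrable (by fun_prop) _ _),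
    intervalIntegral.integral_const_mul, intervalIntegral.integral_const, hftc, smul_eq_mul] at h0
  nlinarith

theorem add_rpow_le {x y q : ℝ} (hx : 0 ≤ x) (hy : 0 ≤ y) (hq : q ∈ Ioc (1:ℝ) 2) :
    (x + y) ^ q ≤ 2 * (x ^ q + y ^ q) := by
  have h : (x + y) ^ q ≤ 2 ^ (q - 1) * (x ^ q + y ^ q) := by
    lift x to NNReal using hx
    lift y to NNReal using hy
    exact_mod_cast NNReal.rpow_add_le_mul_rpow_add_rpow x y hq.1.le
  refine h.trans ?_
  gcongr
  calc (2:ℝ) ^ (q - 1) ≤ 2 ^ (1:ℝ) :=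
        Real.rpow_le_rpow_of_exponent_le (by norm_num) (by linarith [hq.2])
    _ = 2 := by norm_num

theorem rpow_half_le_one_add {x q : ℝ} (hx : 0 ≤ x) (hq : q ∈ Ioc (1:ℝ) 2) :
    x ^ (q / 2) ≤ 1 + x := by
  rcases le_total x 1 with h | h
  · linarith [Real.rpow_le_one hx h (by linarith [hq.1] : 0 ≤ q / 2)]
  · have := Real.rpow_le_rpow_of_exponent_le h (by linarith [hq.2] : q / 2 ≤ 1)
    rw [Real.rpow_one] at this
    linarith

/-- Pointwise bound by averaging over `[x, x + ⟨x⟩^θ]` with `θ = β(1 - q/2)`. -/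
theorem abs_sub_rpow_le_weighted {q β a : ℝ} (hq : q ∈ Ioc (1:ℝ) 2) (hβ : β ∈ Ioo (0:ℝ) 1)
    {f : ℝ → ℝ} (hf : ContDiff ℝ 1 f)
    (hA : Integrable fun y => |f y - a| ^ q * jbr y ^ (-(β * (1 + q / 2))))
    (hB : Integrable fun y => deriv f y ^ 2 * jbr y ^ (-(β * (1 + q / 2)))) (x : ℝ) :
    (|f x - a| / jbr x ^ β) ^ q ≤
      2 * (4 * (∫ y, |f y - a| ^ q * jbr y ^ (-(β * (1 + q / 2)))) +
        (1 + 4 * ∫ y, deriv f y ^ 2 * jbr y ^ (-(β * (1 + q / 2))))) := by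
  obtain ⟨hq1, hq2⟩ := hq
  obtain ⟨hβ0, hβ1⟩ := hβ
  set s := β * (1 + q / 2) with hs
  set θ := β * (1 - q / 2) with hθ
  have hs0 : 0 ≤ s := by positivity
  have hs2 : s ≤ 2 := by nlinarith
  have hθ0 : 0 ≤ θ := mul_nonneg hβ0.le (by linarith)
  have hθ1 : θ ≤ 1 := by nlinarith
  set A := ∫ y, |f y - a| ^ q * jbr y ^ (-s)
  set B := ∫ y, deriv f y ^ 2 * jbr y ^ (-s)
  set J := jbr x with hJ
  have hJ2 : 2 ≤ J := two_le_jbr x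
  have hB0 : 0 ≤ B := integral_nonneg fun y => by
    have := two_le_jbr y
    positivity
  set L := J ^ θ with hL
  have hL0 : 0 < L := by positivity
  have hLJ : L ≤ J := by
    simpa using Real.rpow_le_rpow_of_exponent_le (by linarith : 1 ≤ J) hθ1
  have hd : Continuous (deriv f) := hf.continuous_deriv le_rfl
  have hnear : ∀ y ∈ Icc x (x + L), jbr y ≤ 2 * jbr x := fun y hy =>
    jbr_le_two_mul (by rw [abs_of_nonneg (by linarith [hy.1])]; linarith [hy.2])
  have hfc : Continuous fun y => |f y - a| ^ q :=
    ((hf.continuous.sub continuous_const).abs).rpow_const fun _ => Or.inr (by linarith)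
  have hAI := intervalIntegral_le_weighted hfc (fun y => by positivity) hs0 hs2 hA
    (by linarith : x ≤ x + L) hnear
  have hLs : L * J ^ s = J ^ (2 * β) := by
    rw [hL, ← Real.rpow_add (by linarith)]
    congr 1
    rw [hs, hθ]; ring
  have hpt : ∀ y ∈ Icc x (x + L),
      |f x - a| ^ q ≤ 2 * |f y - a| ^ q + 2 * ((1 + 4 * B) * J ^ (β * q)) := by
    intro y hy
    have h1 : (f y - f x) ^ 2 ≤ 4 * B * J ^ (2 * β) := by
      calc (f y - f x) ^ 2 ≤ (y - x) * ∫ t in x..y, deriv f t ^ 2 :=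
            sq_sub_le_mul_integral_deriv_sq hf hy.1
        _ ≤ L * (4 * J ^ s * B) := by
            refine mul_le_mul (by linarith [hy.2]) ?_
              (intervalIntegral.integral_nonneg hy.1 fun t _ => sq_nonneg _) hL0.le
            exact intervalIntegral_le_weighted (hd.pow 2) (fun y => sq_nonneg _) hs0 hs2 hB hy.1
              fun t ht => hnear t ⟨ht.1, ht.2.trans hy.2⟩
        _ = 4 * B * (L * J ^ s) := by ring
        _ = _ := by rw [hLs]
    have h2 : |f y - f x| ^ q ≤ (1 + 4 * B) * J ^ (β * q) := by
      calc |f y - f x| ^ q = ((f y - f x) ^ 2) ^ (q / 2) := by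
            rw [← sq_abs, ← Real.rpow_natCast, ← Real.rpow_mul (abs_nonneg _)]
            congr 1
            push_cast; ring
        _ ≤ (4 * B * J ^ (2 * β)) ^ (q / 2) :=
            Real.rpow_le_rpow (sq_nonneg _) h1 (by linarith)
        _ = (4 * B) ^ (q / 2) * J ^ (β * q) := by
            rw [Real.mul_rpow (by positivity) (by positivity), ← Real.rpow_mul (by linarith)]
            congr 2
            ring
        _ ≤ _ := by
            gcongr
            exact rpow_half_le_one_add (by positivity) ⟨hq1, hq2⟩
    calc |f x - a| ^ q ≤ (|f y - a| + |f y - f x|) ^ q := by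
          refine Real.rpow_le_rpow (abs_nonneg _) ?_ (by linarith)
          rw [abs_sub_comm (f y) (f x), add_comm]
          exact abs_sub_le _ _ _
      _ ≤ 2 * (|f y - a| ^ q + |f y - f x| ^ q) :=
          add_rpow_le (abs_nonneg _) (abs_nonneg _) ⟨hq1, hq2⟩
      _ ≤ _ := by linarith
  have hint := intervalIntegral.integral_mono_on (by linarith : x ≤ x + L)
    (continuous_const.intervalIntegrable (μ := volume) _ _)
    (Continuous.intervalIntegrable (μ := volume) (by fun_prop) _ _) hpt
  rw [intervalIntegral.integral_add ((hfc.const_mul 2).intervalIntegrable _ _)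
    (continuous_const.intervalIntegrable _ _), intervalIntegral.integral_const_mul,
    intervalIntegral.integral_const, intervalIntegral.integral_const, smul_eq_mul,
    smul_eq_mul, add_sub_cancel_left] at hint
  have hLq : J ^ s = L * J ^ (β * q) := by
    rw [hL, ← Real.rpow_add (by linarith)]
    congr 1
    rw [hs, hθ]; ring
  have hJq : 0 < J ^ (β * q) := by positivity
  rw [Real.div_rpow (abs_nonneg _) (by positivity), ← Real.rpow_mul (by linarith),
    div_le_iff₀ hJq]
  rw [← hJ, hLq] at hAI
  refine le_of_mul_le_mul_left ?_ hL0
  nlinarith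

/-- Pointwise bound for the Hölder quotients. -/
theorem holder_quotient_le {q β γ : ℝ} (hq : q ∈ Ioc (1:ℝ) 2) (hβ : β ∈ Ioo (0:ℝ) 1)
    (hγ : γ ∈ Ioc (0:ℝ) (1 / 2)) {f : ℝ → ℝ} (hf : ContDiff ℝ 1 f)
    (hB : Integrable fun y => deriv f y ^ 2 * jbr y ^ (-(β * (1 + q / 2)))) {x y : ℝ}
    (hne : x ≠ y) (hxy : |x - y| ≤ 1) :
    |f x - f y| / (jbr x ^ β * |x - y| ^ γ) ≤
      Real.sqrt (4 * ∫ y, deriv f y ^ 2 * jbr y ^ (-(β * (1 + q / 2)))) := by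
  obtain ⟨hq1, hq2⟩ := hq
  obtain ⟨hβ0, hβ1⟩ := hβ
  set s := β * (1 + q / 2) with hs
  have hs0 : 0 ≤ s := by positivity
  have hs2 : s ≤ 2 := by nlinarith
  set B := ∫ y, deriv f y ^ 2 * jbr y ^ (-s)
  have hB0 : 0 ≤ B := integral_nonneg fun y => by
    have := two_le_jbr y
    positivity
  have hx2 := two_le_jbr x
  have hpos : 0 < |x - y| := abs_pos.2 (sub_ne_zero.2 hne)
  have hd : Continuous (deriv f) := hf.continuous_deriv le_rfl
  have hloc : (f x - f y) ^ 2 ≤ |x - y| * (4 * jbr x ^ s * B) := by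
    rcases le_total x y with h | h
    · rw [abs_sub_comm, abs_of_nonneg (by linarith)] at hxy ⊢
      have h1 := sq_sub_le_mul_integral_deriv_sq hf h
      have h2 := intervalIntegral_le_weighted (x := x) (h := fun t => deriv f t ^ 2)
        (hd.pow 2) (fun y => sq_nonneg _) hs0 hs2 hB h fun t ht => jbr_le_two_mul (abs_le.2 ⟨by linarith [ht.1], by linarith [ht.2]⟩)
      nlinarith [mul_le_mul_of_nonneg_left h2 (by linarith : 0 ≤ y - x)]
    · rw [abs_of_nonneg (by linarith)] at hxy ⊢
      have h1 := sq_sub_le_mul_integral_deriv_sq hf h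
      have h2 := intervalIntegral_le_weighted (x := x) (h := fun t => deriv f t ^ 2)
        (hd.pow 2) (fun y => sq_nonneg _) hs0 hs2 hB h fun t ht => jbr_le_two_mul (abs_le.2 ⟨by linarith [ht.1], by linarith [ht.2]⟩)
      nlinarith [mul_le_mul_of_nonneg_left h2 (by linarith : 0 ≤ x - y)]
  have hden : |x - y| * jbr x ^ s ≤ (jbr x ^ β * |x - y| ^ γ) ^ 2 := by
    rw [mul_pow, ← Real.rpow_natCast (jbr x ^ β), ← Real.rpow_mul (by linarith),
      ← Real.rpow_natCast (|x - y| ^ γ), ← Real.rpow_mul hpos.le, mul_comm]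
    gcongr
    · linarith
    · push_cast
      nlinarith
    · calc |x - y| = |x - y| ^ (1:ℝ) := (Real.rpow_one _).symm
        _ ≤ _ := Real.rpow_le_rpow_of_exponent_ge hpos hxy (by push_cast; linarith [hγ.2])
  refine Real.le_sqrt_of_sq_le ?_
  rw [div_pow, sq_abs, div_le_iff₀ (by positivity)]
  nlinarith [mul_le_mul_of_nonneg_left hden (by positivity : 0 ≤ 4 * B)]

theorem whnorm_rpow_le {q β γ a : ℝ} (hq : q ∈ Ioc (1:ℝ) 2) (hβ : β ∈ Ioo (0:ℝ) 1)
    (hγ : γ ∈ Ioc (0:ℝ) (1 / 2)) {f : ℝ → ℝ} (hf : ContDiff ℝ 1 f)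
    (hA : Integrable fun y => |f y - a| ^ q * jbr y ^ (-(β * (1 + q / 2))))
    (hB : Integrable fun y => deriv f y ^ 2 * jbr y ^ (-(β * (1 + q / 2)))) :
    whnorm β γ f ^ q ≤ 9 * jbr a ^ 2 +
      48 * ((∫ y, |f y - a| ^ q * jbr y ^ (-(β * (1 + q / 2)))) +
        ∫ y, deriv f y ^ 2 * jbr y ^ (-(β * (1 + q / 2)))) := by
  have hq0 : 0 < q := by linarith [hq.1]
  have hS := abs_sub_rpow_le_weighted hq hβ hf hA hB
  have hH := fun x y => holder_quotient_le hq hβ hγ hf hB (x := x) (y := y)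
  set A := ∫ y, |f y - a| ^ q * jbr y ^ (-(β * (1 + q / 2)))
  set B := ∫ y, deriv f y ^ 2 * jbr y ^ (-(β * (1 + q / 2)))
  have hA0 : 0 ≤ A := integral_nonneg fun y => by
    have := two_le_jbr y
    positivity
  have hB0 : 0 ≤ B := integral_nonneg fun y => by
    have := two_le_jbr y
    positivity
  set T := 2 * (4 * A + (1 + 4 * B)) with hT
  have hT0 : 0 ≤ T := by positivity
  have hsup : (⨆ x : ℝ, |f x| / jbr x ^ β) ≤ |a| + T ^ (1 / q) := by
    refine ciSup_le fun x => ?_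
    have hx := two_le_jbr x
    have hw : 1 ≤ jbr x ^ β := Real.one_le_rpow (by linarith) hβ.1.le
    have h1 : |f x - a| / jbr x ^ β ≤ T ^ (1 / q) := by
      rw [one_div]
      exact (Real.le_rpow_inv_iff_of_pos (by positivity) hT0 hq0).2 (hS x)
    calc |f x| / jbr x ^ β ≤ (|a| + |f x - a|) / jbr x ^ β := by
          gcongr
          have := abs_add_le a (f x - a)
          rwa [add_sub_cancel] at this
      _ = |a| / jbr x ^ β + |f x - a| / jbr x ^ β := add_div _ _ _
      _ ≤ _ := add_le_add (div_le_self (abs_nonneg _) hw) h1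
  have hhol : (⨆ p : {p : ℝ × ℝ // p.1 ≠ p.2 ∧ |p.1 - p.2| ≤ 1},
      |f p.1.1 - f p.1.2| / (jbr p.1.1 ^ β * |p.1.1 - p.1.2| ^ γ)) ≤ Real.sqrt (4 * B) :=
    Real.iSup_le (fun p => hH _ _ p.2.1 p.2.2) (Real.sqrt_nonneg _)
  have hnonneg : 0 ≤ whnorm β γ f := by
    refine add_nonneg (Real.iSup_nonneg fun x => ?_) (Real.iSup_nonneg fun p => ?_)
    · have := two_le_jbr x
      positivity
    · have := two_le_jbr p.1.1
      positivity
  have ha : |a| ^ q ≤ jbr a ^ 2 := by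
    have := two_le_jbr a
    calc |a| ^ q ≤ jbr a ^ q := Real.rpow_le_rpow (abs_nonneg _) (abs_le_jbr a) hq0.le
      _ ≤ jbr a ^ (2:ℝ) := Real.rpow_le_rpow_of_exponent_le (by linarith) hq.2
      _ = jbr a ^ 2 := by norm_cast
  have hTq : (T ^ (1 / q)) ^ q = T := by
    rw [one_div, Real.rpow_inv_rpow hT0 hq0.ne']
  have hBq : Real.sqrt (4 * B) ^ q ≤ 1 + 4 * B := by
    rw [Real.sqrt_eq_rpow, ← Real.rpow_mul (by positivity), show 1 / 2 * q = q / 2 by ring]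
    exact rpow_half_le_one_add (by positivity) hq
  have hTn : 0 ≤ T ^ (1 / q) := by positivity
  have h1 : whnorm β γ f ^ q ≤ (|a| + (T ^ (1 / q) + Real.sqrt (4 * B))) ^ q :=
    Real.rpow_le_rpow hnonneg (by unfold whnorm; linarith) hq0.le
  have h2 := add_rpow_le (abs_nonneg a) (add_nonneg hTn (Real.sqrt_nonneg (4 * B))) hq
  have h3 := add_rpow_le hTn (Real.sqrt_nonneg (4 * B)) hq
  rw [hTq] at h3
  have h4 : 4 ≤ jbr a ^ 2 := by nlinarith [two_le_jbr a]
  linarith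

/-- The spatial derivative of a measurable random field with a.s. `C¹` paths is a.e. measurable. -/
theorem aemeasurable_deriv_of_ae_contDiff {Ω : Type*} [MeasurableSpace Ω] {P : Measure Ω}
    [SFinite P] {v : Ω → ℝ → ℝ} (hv : Measurable fun p : Ω × ℝ => v p.1 p.2)
    (hd : ∀ᵐ ω ∂P, ContDiff ℝ 1 (v ω)) :
    AEMeasurable (fun p : Ω × ℝ => deriv (v p.1) p.2) (P.prod volume) := by
  refine aemeasurable_of_tendsto_metrizable_ae (u := Filter.atTop)
    (f := fun (n : ℕ) (p : Ω × ℝ) =>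
      ((1 / ((n : ℝ) + 1)))⁻¹ * (v p.1 (p.2 + 1 / ((n : ℝ) + 1)) - v p.1 p.2)) ?_ ?_
  · intro n
    have h : Measurable fun p : Ω × ℝ => v p.1 (p.2 + 1 / ((n : ℝ) + 1)) :=
      hv.comp (measurable_fst.prodMk (measurable_snd.add_const _))
    exact ((h.sub hv).const_mul _).aemeasurable
  · filter_upwards [Measure.quasiMeasurePreserving_fst.ae hd] with p hp
    have hder : HasDerivAt (v p.1) (deriv (v p.1) p.2) p.2 :=
      ((hp.differentiable one_ne_zero) p.2).hasDerivAt
    have := hder.tendsto_slope_zero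
    refine this.comp (tendsto_nhdsWithin_iff.2
      ⟨tendsto_one_div_add_atTop_nhds_zero_nat, Filter.Eventually.of_forall fun n => ?_⟩)
    simp only [mem_compl_iff, mem_singleton_iff]
    positivity

theorem integrable_of_lintegral_ofReal_lt_top {h : ℝ → ℝ} (hc : Continuous h) (h0 : ∀ y, 0 ≤ h y)
    (hi : ∫⁻ y, ENNReal.ofReal (h y) < ⊤) : Integrable h :=
  ⟨hc.aestronglyMeasurable,
    (hasFiniteIntegral_iff_ofReal (ae_of_all _ h0)).2 hi⟩

theorem ofReal_whnorm_rpow_le {q β γ a : ℝ} (hq : q ∈ Ioc (1:ℝ) 2) (hβ : β ∈ Ioo (0:ℝ) 1)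
    (hγ : γ ∈ Ioc (0:ℝ) (1 / 2)) {f : ℝ → ℝ} (hf : ContDiff ℝ 1 f) :
    ENNReal.ofReal (whnorm β γ f ^ q) ≤ ENNReal.ofReal (9 * jbr a ^ 2) +
      48 * ∫⁻ y, (ENNReal.ofReal (|f y - a| ^ q) + ENNReal.ofReal (deriv f y ^ 2)) *
        ENNReal.ofReal (jbr y ^ (-(β * (1 + q / 2)))) := by
  set s := β * (1 + q / 2)
  have hw : ∀ y, 0 ≤ jbr y ^ (-s) := fun y => by
    have := two_le_jbr y
    positivity
  have hcA : Continuous fun y => |f y - a| ^ q * jbr y ^ (-s) :=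
    (((hf.continuous.sub continuous_const).abs).rpow_const
      fun _ => Or.inr (by linarith [hq.1])).mul (continuous_jbr_rpow _)
  have hcB : Continuous fun y => deriv f y ^ 2 * jbr y ^ (-s) :=
    ((hf.continuous_deriv le_rfl).pow 2).mul (continuous_jbr_rpow _)
  have hA0 : ∀ y, 0 ≤ |f y - a| ^ q * jbr y ^ (-s) := fun y => mul_nonneg (by positivity) (hw y)
  have hB0 : ∀ y, 0 ≤ deriv f y ^ 2 * jbr y ^ (-s) := fun y => mul_nonneg (by positivity) (hw y)
  have hM : ∫⁻ y, (ENNReal.ofReal (|f y - a| ^ q) + ENNReal.ofReal (deriv f y ^ 2)) *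
      ENNReal.ofReal (jbr y ^ (-s)) =
      (∫⁻ y, ENNReal.ofReal (|f y - a| ^ q * jbr y ^ (-s))) +
        ∫⁻ y, ENNReal.ofReal (deriv f y ^ 2 * jbr y ^ (-s)) := by
    rw [← lintegral_add_left hcA.measurable.ennreal_ofReal]
    refine lintegral_congr fun y => ?_
    rw [add_mul, ENNReal.ofReal_mul (by positivity), ENNReal.ofReal_mul (by positivity)]
  rw [hM]
  rcases eq_or_ne (∫⁻ y, ENNReal.ofReal (|f y - a| ^ q * jbr y ^ (-s))) ⊤ with h | hAt
  · simp [h]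
  rcases eq_or_ne (∫⁻ y, ENNReal.ofReal (deriv f y ^ 2 * jbr y ^ (-s))) ⊤ with h | hBt
  · simp [h]
  have hA := integrable_of_lintegral_ofReal_lt_top hcA hA0 hAt.lt_top
  have hB := integrable_of_lintegral_ofReal_lt_top hcB hB0 hBt.lt_top
  rw [← ofReal_integral_eq_lintegral_ofReal hA (ae_of_all _ hA0),
    ← ofReal_integral_eq_lintegral_ofReal hB (ae_of_all _ hB0),
    ← ENNReal.ofReal_add (integral_nonneg hA0) (integral_nonneg hB0),
    show (48 : ENNReal) = ENNReal.ofReal 48 by simp, ← ENNReal.ofReal_mul (by norm_num),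
    ← ENNReal.ofReal_add (by positivity)
      (mul_nonneg (by norm_num) (add_nonneg (integral_nonneg hA0) (integral_nonneg hB0)))]
  exact ENNReal.ofReal_le_ofReal (whnorm_rpow_le hq hβ hγ hf hA hB)

/-- Moment bound for the weighted Hölder norm of a random field: pointwise `q`-th
moment and derivative second-moment bounds imply a `q`-th moment bound on the
weighted Hölder norm, with constant depending only on `q`, `β`, `γ`, `C₀`. -/
theorem holder_norm_moment_bound
    (q β γ C₀ : ℝ) (hq : q ∈ Ioc (1:ℝ) 2) (hβ : β ∈ Ioo (2 / (2 + q)) 1)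
    (hγ : γ ∈ Ioc (0:ℝ) (1/2)) (hC₀ : 0 < C₀) :
    ∃ C : ℝ,
      ∀ (Ω : Type) [MeasurableSpace Ω] (P : Measure Ω), IsProbabilityMeasure P →
      ∀ (a : ℝ) (v : Ω → ℝ → ℝ),
        Measurable (fun p : Ω × ℝ => v p.1 p.2) →
        (∀ᵐ ω ∂P, ContDiff ℝ 1 (v ω)) →
        (∀ x : ℝ, (∫⁻ ω, ENNReal.ofReal (|v ω x - a| ^ q) ∂P) ≤
          ENNReal.ofReal (C₀ * jbr a ^ 2)) →
        (∀ x : ℝ, (∫⁻ ω, ENNReal.ofReal ((deriv (v ω) x) ^ 2) ∂P) ≤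
          ENNReal.ofReal C₀) →
        (∫⁻ ω, ENNReal.ofReal (whnorm β γ (v ω) ^ q) ∂P) ≤
          ENNReal.ofReal (C * jbr a ^ 2) := by
  have hβ01 : β ∈ Ioo (0:ℝ) 1 :=
    ⟨lt_trans (div_pos two_pos (by linarith [hq.1])) hβ.1, hβ.2⟩
  have hs : 1 < β * (1 + q / 2) := by
    have := (div_lt_iff₀ (by linarith [hq.1] : 0 < 2 + q)).1 hβ.1
    linarith
  set s := β * (1 + q / 2) with hsdef
  set K := ∫ y, jbr y ^ (-s) with hK
  have hw : ∀ y, 0 ≤ jbr y ^ (-s) := fun y => by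
    have := two_le_jbr y
    positivity
  have hK0 : 0 ≤ K := integral_nonneg hw
  refine ⟨9 + 96 * C₀ * K, ?_⟩
  intro Ω _ P _ a v hv hd hA hB
  have hmeas : AEMeasurable (fun p : Ω × ℝ =>
      (ENNReal.ofReal (|v p.1 p.2 - a| ^ q) + ENNReal.ofReal (deriv (v p.1) p.2 ^ 2)) *
        ENNReal.ofReal (jbr p.2 ^ (-s))) (P.prod volume) := by
    have h1 : Measurable fun p : Ω × ℝ => |v p.1 p.2 - a| ^ q :=
      (continuous_abs.measurable.comp (hv.sub_const a)).pow_const q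
    have h2 := (aemeasurable_deriv_of_ae_contDiff hv hd).pow_const 2
    have h3 : Measurable fun p : Ω × ℝ => jbr p.2 ^ (-s) :=
      (continuous_jbr_rpow (-s)).measurable.comp measurable_snd
    exact (h1.ennreal_ofReal.aemeasurable.add h2.ennreal_ofReal).mul h3.ennreal_ofReal.aemeasurable
  have hinner : ∀ y, (∫⁻ ω, (ENNReal.ofReal (|v ω y - a| ^ q) +
      ENNReal.ofReal (deriv (v ω) y ^ 2)) * ENNReal.ofReal (jbr y ^ (-s)) ∂P) ≤
      ENNReal.ofReal (2 * C₀ * jbr a ^ 2) * ENNReal.ofReal (jbr y ^ (-s)) := by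
    intro y
    have hvy : Measurable fun ω => |v ω y - a| ^ q :=
      (continuous_abs.measurable.comp
        ((hv.comp (measurable_id.prodMk measurable_const)).sub_const a)).pow_const q
    rw [lintegral_mul_const' _ _ ENNReal.ofReal_ne_top, lintegral_add_left hvy.ennreal_ofReal]
    gcongr
    refine (add_le_add (hA y) (hB y)).trans ?_
    rw [← ENNReal.ofReal_add (by positivity) hC₀.le]
    refine ENNReal.ofReal_le_ofReal ?_
    have h4 : 1 ≤ jbr a ^ 2 := by nlinarith [two_le_jbr a]
    nlinarith
  calc ∫⁻ ω, ENNReal.ofReal (whnorm β γ (v ω) ^ q) ∂P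
      ≤ ∫⁻ ω, (ENNReal.ofReal (9 * jbr a ^ 2) +
        48 * ∫⁻ y, (ENNReal.ofReal (|v ω y - a| ^ q) + ENNReal.ofReal (deriv (v ω) y ^ 2)) *
          ENNReal.ofReal (jbr y ^ (-s))) ∂P :=
        lintegral_mono_ae (hd.mono fun ω hω => ofReal_whnorm_rpow_le hq hβ01 hγ hω)
    _ = ENNReal.ofReal (9 * jbr a ^ 2) + 48 * ∫⁻ y, ∫⁻ ω, (ENNReal.ofReal (|v ω y - a| ^ q) +
          ENNReal.ofReal (deriv (v ω) y ^ 2)) * ENNReal.ofReal (jbr y ^ (-s)) ∂P := by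
        rw [lintegral_add_left measurable_const, lintegral_const, measure_univ, mul_one,
          lintegral_const_mul' _ _ (by simp), lintegral_lintegral_swap hmeas]
    _ ≤ ENNReal.ofReal (9 * jbr a ^ 2) +
          48 * ∫⁻ y, ENNReal.ofReal (2 * C₀ * jbr a ^ 2) * ENNReal.ofReal (jbr y ^ (-s)) := by
        gcongr with y
        exact hinner y
    _ = ENNReal.ofReal ((9 + 96 * C₀ * K) * jbr a ^ 2) := by
        rw [lintegral_const_mul' _ _ ENNReal.ofReal_ne_top,
          ← ofReal_integral_eq_lintegral_ofReal (integrable_jbr_rpow_neg hs) (ae_of_all _ hw),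
          ← hK, show (48 : ENNReal) = ENNReal.ofReal 48 by simp,
          ← ENNReal.ofReal_mul (by positivity), ← ENNReal.ofReal_mul (by norm_num),
          ← ENNReal.ofReal_add (by positivity) (by positivity)]
        congr 1
        ring
end
end
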